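/- arXiv:1907.12312 — 2 statements merged into one kernel-verified Lean document; each statement's English description precedes it below -/
import Mathlib

section
/- Let Q ⊂ ℝ^2 be a lattice polygon (a 2-dimensional lattice polytope) and let P ⊂ ℝ^2 be a lattice polytope that is a weak Minkowski summand of Q. Then the Cayley sum Cay(P,Q) ⊂ ℝ^3 has a unimodular cover. -/
open scoped Pointwise

noncomputable section

/-- The real point corresponding to an integer point of `ℤ³`. -/
def toR3 (v : Fin 3 → ℤ) : Fin 3 → ℝ := fun i => (v i : ℝ)

/-- The real point corresponding to an integer point of `ℤ²`. -/
def toR2 (v : Fin 2 → ℤ) : Fin 2 → ℝ := fun i => (v i : ℝ)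

/-- A unimodular tetrahedron: the convex hull of lattice points `v0, v1, v2, v3`
such that `v1 - v0, v2 - v0, v3 - v0` form a `ℤ`-basis of `ℤ³`. -/
def IsUnimodularTet (S : Set (Fin 3 → ℝ)) : Prop :=
  ∃ v : Fin 4 → Fin 3 → ℤ,
    S = convexHull ℝ {toR3 (v 0), toR3 (v 1), toR3 (v 2), toR3 (v 3)} ∧
    (Matrix.of ![v 1 - v 0, v 2 - v 0, v 3 - v 0]).det ∈ ({1, -1} : Set ℤ)

/-- A unimodular cover of `P`. -/
def HasUnimodularCover (P : Set (Fin 3 → ℝ)) : Prop :=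
  ∃ 𝒞 : Set (Set (Fin 3 → ℝ)),
    (∀ S ∈ 𝒞, IsUnimodularTet S ∧ S ⊆ P) ∧ ⋃₀ 𝒞 = P

/-- A lattice polytope in `ℝ²`: the convex hull of a nonempty finite set of
lattice points. -/
def IsLatticePolytope2 (P : Set (Fin 2 → ℝ)) : Prop :=
  ∃ V : Finset (Fin 2 → ℤ), V.Nonempty ∧ P = convexHull ℝ (toR2 '' ↑V)

/-- A (not necessarily lattice) polytope in `ℝ²`. -/
def IsPolytope2 (P : Set (Fin 2 → ℝ)) : Prop :=
  ∃ V : Finset (Fin 2 → ℝ), V.Nonempty ∧ P = convexHull ℝ ↑V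

/-- `P` is a weak Minkowski summand of `Q`: there are a polytope `P'` and a real
`k > 0` with `P + P' = kQ` (equivalently, the normal fan of `Q` refines that
of `P`). -/
def IsWeakMinkowskiSummand (P Q : Set (Fin 2 → ℝ)) : Prop :=
  ∃ P' : Set (Fin 2 → ℝ), IsPolytope2 P' ∧ ∃ k : ℝ, 0 < k ∧ P + P' = k • Q

/-- The Cayley sum `Cay(P,Q) = conv(P×{0} ∪ Q×{1}) ⊆ ℝ³`. -/
def cay (P Q : Set (Fin 2 → ℝ)) : Set (Fin 3 → ℝ) :=
  convexHull ℝ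
    ((fun x => Fin.snoc x (0:ℝ)) '' P ∪ (fun x => Fin.snoc x (1:ℝ)) '' Q)

theorem lemB (L : ℤ → ℤ → Prop) (N : ℤ) (hN : 2 ≤ N)
    (hlin : ∀ x y x' y' k, L x y → L x' y' → L (x + k * x') (y + k * y'))
    (h10 : L N 0) (h01 : L 0 N) (hx : ∀ x, L x 0 → N ∣ x) (hy : ∀ y, L 0 y → N ∣ y)
    (hA : ∃ q, L 1 q) (hB : ∃ q, L q 1) (s t : ℝ) (ht : 0 < t)
    (hs : ∀ x y : ℤ, L x y → 0 < y → y < N → 0 < x → s * y < x)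
    (ht' : ∀ x y : ℤ, L x y → 0 < x → x < N → 0 < y → t * x < y)
    (dx dy : ℤ) (hd : L dx dy) (hdt : (dy : ℝ) = t * dx) (hdN : N ≤ dx)
    (hlt : (dx : ℝ) < s * dy + N) : False := by
  have hN0 : (0:ℝ) < N := by exact_mod_cast (by omega : (0:ℤ) < N)
  obtain ⟨q1, hq1, hq1a, hq1b⟩ : ∃ q, L 1 q ∧ 0 < q ∧ q < N := by
    obtain ⟨q, hq⟩ := hA
    have h := hlin _ _ _ _ (-(q / N)) hq h01
    have e : q + -(q / N) * N = q % N := by have := Int.emod_add_mul_ediv q N; linarith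
    rw [e] at h
    simp only [mul_zero, add_zero] at h
    refine ⟨_, h, ?_, Int.emod_lt_of_pos _ (by omega)⟩
    rcases (Int.emod_nonneg q (by omega : N ≠ 0)).lt_or_eq with h1 | h1
    · exact h1
    · rw [← h1] at h
      have := Int.le_of_dvd (by norm_num) (hx _ h)
      omega
  obtain ⟨q2, hq2, hq2a, hq2b⟩ : ∃ q, L q 1 ∧ 0 < q ∧ q < N := by
    obtain ⟨q, hq⟩ := hB
    have h := hlin _ _ _ _ (-(q / N)) hq h10
    have e : q + -(q / N) * N = q % N := by have := Int.emod_add_mul_ediv q N; linarith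
    rw [e] at h
    simp only [mul_zero, add_zero] at h
    refine ⟨_, h, ?_, Int.emod_lt_of_pos _ (by omega)⟩
    rcases (Int.emod_nonneg q (by omega : N ≠ 0)).lt_or_eq with h1 | h1
    · exact h1
    · rw [← h1] at h
      have := Int.le_of_dvd (by norm_num) (hy _ h)
      omega
  have s1 : s * q1 < 1 := by simpa using hs 1 q1 hq1 hq1a hq1b (by norm_num)
  have t1 : t * q2 < 1 := by simpa using ht' q2 1 hq2 hq2a hq2b (by norm_num)
  have q1R : (1:ℝ) ≤ q1 := by exact_mod_cast hq1a
  have q2R : (1:ℝ) ≤ q2 := by exact_mod_cast hq2a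
  have tlt : t < 1 := by nlinarith
  have hdxR : (N:ℝ) ≤ dx := by exact_mod_cast hdN
  have hdx1 : N + 1 ≤ dx := by
    by_contra hcon
    have e : dx = N := by omega
    have h := hlin _ _ _ _ (-1) hd h10
    have e2 : dx + -1 * N = 0 := by omega
    rw [e2] at h
    simp only [mul_zero, add_zero] at h
    obtain ⟨m, hm⟩ := hy _ h
    rw [hm, e] at hdt
    push_cast at hdt
    have hm' : (m:ℝ) = t := by
      have : (N:ℝ) * m = N * t := by linarith
      exact mul_left_cancel₀ hN0.ne' this
    have a1 : (0:ℝ) < m := by rw [hm']; exact ht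
    have a2 : (m:ℝ) < 1 := by rw [hm']; exact tlt
    have a1' : 0 < m := by exact_mod_cast a1
    have a2' : m < 1 := by exact_mod_cast a2
    omega
  have hdx1R : (N:ℝ) + 1 ≤ dx := by exact_mod_cast hdx1
  have hdy : (0:ℝ) < dy := by rw [hdt]; apply mul_pos ht; linarith
  have hspos : 0 < s := by
    by_contra hcon
    nlinarith
  have st : (N:ℝ) + 1 ≤ 1 / (s * t) → False := by
    intro h
    rw [le_div_iff₀ (by positivity)] at h
    rw [hdt] at hlt
    have : s * t < 1 := by nlinarith
    nlinarith [mul_nonneg (sub_nonneg.2 hdx1R) (sub_nonneg.2 this.le)]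
  have hst : 1 < (N + 1) * (s * t) := by
    by_contra hcon
    apply st
    rw [le_div_iff₀ (by positivity)]
    linarith
  have hqq : (s * t) * (q1 * q2) < 1 := by
    have : (s * q1) * (t * q2) < 1 := by
      have : 0 < s * q1 := by positivity
      have : 0 < t * q2 := by positivity
      nlinarith
    linarith
  have hlt2 : (q1 * q2 : ℝ) < N + 1 := by
    by_contra hcon
    have : 0 < s * t := by positivity
    nlinarith
  have hlt3 : q1 * q2 < N + 1 := by exact_mod_cast hlt2
  have hdv : N ∣ q1 * q2 - 1 := by
    have h := hlin _ _ _ _ q2 (hlin _ _ _ _ (-2) hq2 hq2) hq1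
    apply hy
    convert h using 1 <;> ring
  have hone : q1 * q2 = 1 := by
    have : 0 < q1 * q2 := by positivity
    obtain ⟨m, hm⟩ := hdv
    have : m < 1 := by by_contra hc; nlinarith
    have : -1 < m := by by_contra hc; nlinarith
    have : m = 0 := by omega
    subst this
    linarith
  have hq11 : q1 = 1 := by nlinarith
  subst hq11
  have h := hlin _ _ _ _ (-(dx - N)) (hlin _ _ _ _ (-1) hd h10) hq1
  have hdv2 : N ∣ dy - dx + N := by
    apply hy
    convert h using 1 <;> ring
  have hs1 : s < 1 := by simpa using s1
  have h1 : (0:ℝ) < dy - dx + N := by nlinarith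
  have h2 : 0 < dy - dx + N := by exact_mod_cast h1
  have h3 := Int.le_of_dvd h2 hdv2
  have h4 : (dy:ℝ) < dx := by rw [hdt]; nlinarith
  have h5 : dy < dx := by exact_mod_cast h4
  omega

theorem lemLine {ι : Type*} (V : Finset ι) (X Y : ι → ℤ) (L : ℤ → ℤ → Prop) (N : ℤ)
    (hN : 0 < N) (hsh : ∀ x y k, L x y → L (x + k * N) y)
    (hVL : ∀ i ∈ V, L (X i) (Y i)) (C : ℝ → ℝ → Prop)
    (hC : ∀ x y x' y' a b : ℝ, C x y → C x' y' → 0 ≤ a → 0 ≤ b → a + b = 1 →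
      C (a * x + b * x') (a * y + b * y'))
    (hVC : ∀ i ∈ V, C (X i) (Y i)) (i0 i1 : ι) (hi0 : i0 ∈ V) (hi1 : i1 ∈ V)
    (h00 : X i0 = 0) (h01 : Y i0 = 0) (h10 : X i1 = 0) (h11 : Y i1 = N)
    (hno : ∀ x y : ℤ, L x y → C x y → 0 < y → y < N → |x| < N → False) :
    (∀ i ∈ V, Y i ≤ 0 ∨ N ≤ Y i) ∧ ∃ s r : ℝ, (∀ i ∈ V, (X i : ℝ) ≤ s * Y i + r) ∧
      (∃ v ∈ V, ∃ w ∈ V, Y v ≤ 0 ∧ N ≤ Y w ∧ (X v : ℝ) = s * Y v + r ∧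
        (X w : ℝ) = s * Y w + r) ∧
      ∀ x y : ℤ, L x y → 0 < y → y < N → 0 < x → s * y + r < x := by
  have hN0 : (0:ℝ) < N := by exact_mod_cast hN
  have C0 : ∀ y : ℝ, 0 < y → y < N → C 0 y := by
    intro y h1 h2
    have := hC _ _ _ _ (1 - y / N) (y / N) (hVC _ hi0) (hVC _ hi1)
      (by rw [sub_nonneg, div_le_one hN0]; exact h2.le) (by positivity) (by ring)
    rw [h00, h01, h10, h11] at this
    convert this using 1
    · simp
    · simp; field_simp
  have Cmid : ∀ x y z : ℝ, C x y → 0 < y → y < N → (0 ≤ z ∧ z ≤ x ∨ x ≤ z ∧ z ≤ 0) → C z y := by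
    intro x y z h h1 h2 h3
    by_cases hx : x = 0
    · have : z = x := by rcases h3 with h3 | h3 <;> linarith [h3.1, h3.2]
      rw [this]; exact h
    have h0 : 0 ≤ z / x := by
      rcases h3 with h3 | h3
      · exact div_nonneg h3.1 (by linarith [h3.1, h3.2])
      · exact div_nonneg_of_nonpos h3.2 (by linarith [h3.1, h3.2])
    have h1' : z / x ≤ 1 := by
      rcases h3 with h3 | h3
      · exact div_le_one_of_le₀ h3.2 (by linarith [h3.1, h3.2])
      · exact div_le_one_of_ge h3.1 (by linarith [h3.1, h3.2])
    have := hC _ _ _ _ (1 - z / x) (z / x) (C0 y h1 h2) h (by linarith) h0 (by ring)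
    convert this using 1
    · field_simp; ring
    · ring
  have key : ∀ x y : ℤ, L x y → C x y → 0 < y → y < N → False := by
    intro x y hL hc h1 h2
    have h1R : (0:ℝ) < y := by exact_mod_cast h1
    have h2R : (y:ℝ) < N := by exact_mod_cast h2
    rcases le_total 0 x with hx | hx
    · have e : x + -(x / N) * N = x % N := by have := Int.emod_add_mul_ediv x N; linarith
      have hL' := hsh _ _ (-(x / N)) hL
      rw [e] at hL'
      have a := Int.emod_nonneg x hN.ne'
      have b := Int.emod_lt_of_pos x hN
      have c : x % N ≤ x := by
        have := Int.ediv_nonneg hx hN.le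
        nlinarith
      refine hno _ _ hL' (Cmid _ _ _ hc h1R h2R (Or.inl ⟨?_, ?_⟩)) h1 h2 (by rw [abs_of_nonneg a]; exact b)
      · exact_mod_cast a
      · exact_mod_cast c
    · have e : x + ((-x) / N) * N = -((-x) % N) := by
        have := Int.emod_add_mul_ediv (-x) N; linarith
      have hL' := hsh _ _ ((-x) / N) hL
      rw [e] at hL'
      have a := Int.emod_nonneg (-x) hN.ne'
      have b := Int.emod_lt_of_pos (-x) hN
      have c : x ≤ -((-x) % N) := by
        have := Int.ediv_nonneg (by omega : 0 ≤ -x) hN.le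
        nlinarith
      refine hno _ _ hL' (Cmid _ _ _ hc h1R h2R (Or.inr ⟨?_, ?_⟩)) h1 h2
        (by rw [abs_neg, abs_of_nonneg a]; exact b)
      · exact_mod_cast c
      · exact_mod_cast (by omega : -((-x) % N) ≤ 0)
  have hdich : ∀ i ∈ V, Y i ≤ 0 ∨ N ≤ Y i := by
    intro i hi
    by_contra hcon
    push Not at hcon
    exact key _ _ (hVL i hi) (hVC i hi) hcon.1 hcon.2
  refine ⟨hdich, ?_⟩
  let F : ι × ι → ℝ := fun p =>
    (X p.1 * (Y p.2 - N / 2) + X p.2 * (N / 2 - Y p.1)) / (Y p.2 - Y p.1)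
  obtain ⟨⟨v, w⟩, hvw, hmax⟩ := Finset.exists_max_image
    ((V.filter fun i => Y i ≤ 0) ×ˢ (V.filter fun i => N ≤ Y i)) F
    ⟨(i0, i1), by simp [hi0, hi1, h01, h11]⟩
  simp only [Finset.mem_product, Finset.mem_filter] at hvw hmax
  obtain ⟨⟨hv, hv0⟩, hw, hw0⟩ := hvw
  have hv0R : (Y v : ℝ) ≤ 0 := by exact_mod_cast hv0
  have hw0R : (N:ℝ) ≤ Y w := by exact_mod_cast hw0
  have hd : (0:ℝ) < Y w - Y v := by linarith
  obtain ⟨s, hs⟩ : ∃ s : ℝ, s = (X w - X v) / (Y w - Y v) := ⟨_, rfl⟩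
  obtain ⟨r, hr⟩ : ∃ r : ℝ, r = X v - s * Y v := ⟨_, rfl⟩
  have ev : (X v : ℝ) = s * Y v + r := by rw [hr]; ring
  have ew : (X w : ℝ) = s * Y w + r := by
    rw [hr, hs]; field_simp; ring
  have eF : F (v, w) = s * (N / 2) + r := by
    simp only [F]; rw [ev, ew]; field_simp; ring
  refine ⟨s, r, ?_, ⟨v, hv, w, hw, hv0, hw0, ev, ew⟩, ?_⟩
  · intro u hu
    by_contra hcon
    push Not at hcon
    rcases hdich u hu with h | h
    · have h1 := hmax (u, w) ⟨⟨hu, h⟩, hw, hw0⟩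
      have hR : (Y u : ℝ) ≤ 0 := by exact_mod_cast h
      rw [eF] at h1
      simp only [F] at h1
      rw [div_le_iff₀ (by linarith), ew] at h1
      nlinarith [mul_pos (sub_pos.2 hcon) (by linarith : (0:ℝ) < Y w - N / 2)]
    · have h1 := hmax (v, u) ⟨⟨hv, hv0⟩, hu, h⟩
      have hR : (N : ℝ) ≤ Y u := by exact_mod_cast h
      rw [eF] at h1
      simp only [F] at h1
      rw [div_le_iff₀ (by linarith), ev] at h1
      nlinarith [mul_pos (sub_pos.2 hcon) (by linarith : (0:ℝ) < N / 2 - Y v)]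
  · intro x y hL h1 h2 hx
    by_contra hcon
    push Not at hcon
    have h1R : (0:ℝ) < y := by exact_mod_cast h1
    have h2R : (y:ℝ) < N := by exact_mod_cast h2
    have hxR : (0:ℝ) < x := by exact_mod_cast hx
    refine key x y hL (Cmid (s * y + r) y x ?_ h1R h2R (Or.inl ⟨hxR.le, hcon⟩)) h1 h2
    have := hC _ _ _ _ ((Y w - y) / (Y w - Y v)) ((y - Y v) / (Y w - Y v)) (hVC v hv) (hVC w hw)
      (div_nonneg (by linarith) hd.le) (div_nonneg (by linarith) hd.le) (by field_simp; ring)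
    convert this using 1
    · rw [ev, ew]; field_simp; ring
    · field_simp; ring

theorem lemRed (L : ℤ → ℤ → Prop) (N : ℤ) (hN : 2 ≤ N)
    (hlin : ∀ x y x' y' k, L x y → L x' y' → L (x + k * x') (y + k * y'))
    (h10 : L N 0) (hy : ∀ y, L 0 y → N ∣ y)
    (hB : ∃ q, L q 1) : ∃ q, L q 1 ∧ 0 < q ∧ q < N := by
  obtain ⟨q, hq⟩ := hB
  have h := hlin _ _ _ _ (-(q / N)) hq h10
  have e : q + -(q / N) * N = q % N := by have := Int.emod_add_mul_ediv q N; linarith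
  rw [e] at h
  simp only [mul_zero, add_zero] at h
  refine ⟨_, h, ?_, Int.emod_lt_of_pos _ (by omega)⟩
  rcases (Int.emod_nonneg q (by omega : N ≠ 0)).lt_or_eq with h1 | h1
  · exact h1
  · rw [← h1] at h
    have := Int.le_of_dvd (by norm_num) (hy _ h)
    omega

set_option maxHeartbeats 1000000 in
theorem lemA {ι : Type*} (V : Finset ι) (X Y : ι → ℤ) (L : ℤ → ℤ → Prop) (N : ℤ) (hN : 2 ≤ N)
    (hlin : ∀ x y x' y' k, L x y → L x' y' → L (x + k * x') (y + k * y'))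
    (h10 : L N 0) (h01 : L 0 N) (hx : ∀ x, L x 0 → N ∣ x) (hy : ∀ y, L 0 y → N ∣ y)
    (hA : ∃ q, L 1 q) (hB : ∃ q, L q 1)
    (hVL : ∀ i ∈ V, L (X i) (Y i)) (hdich : ∀ i ∈ V, Y i ≤ 0 ∨ N ≤ Y i)
    (j0 : ι) (hj0 : j0 ∈ V) (e0x : X j0 = 0) (e0y : Y j0 = 0)
    (s r s' r' : ℝ) (hr : 0 ≤ r) (hsr : 0 ≤ s * N + r) (hr' : 0 ≤ r') (hsr' : s' * N - r' ≤ 0)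
    (hR : ∀ i ∈ V, (X i : ℝ) ≤ s * Y i + r) (hLf : ∀ i ∈ V, s' * Y i - r' ≤ X i)
    (hRs : ∀ x y : ℤ, L x y → 0 < y → y < N → 0 < x → s * y + r < x)
    (hLs : ∀ x y : ℤ, L x y → 0 < y → y < N → x < 0 → x < s' * y - r')
    (hss : s' ≤ s)
    (t ρ : ℝ) (hρ : 0 ≤ ρ) (htρ : t * N ≤ ρ)
    (hT : ∀ x y : ℤ, L x y → 0 < x → x < N → y < 0 → y < t * x - ρ)
    (xp yp : ℤ) (hp : L xp yp) (hxp : xp ≤ 0) (hyp : (yp : ℝ) = t * xp - ρ)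
    (w w' : ι) (hw : w ∈ V) (hw' : w' ∈ V) (hne : X w ≠ X w' ∨ Y w ≠ Y w')
    (hmin : ∀ i ∈ V, (Y w : ℝ) - t * X w ≤ Y i - t * X i)
    (hmin' : ∀ i ∈ V, (Y w' : ℝ) - t * X w' ≤ Y i - t * X i) : False := by
  have hN0 : (0:ℝ) < N := by exact_mod_cast (by omega : (0:ℤ) < N)
  have hN2 : (2:ℝ) ≤ N := by exact_mod_cast hN
  have heq : (Y w : ℝ) - t * X w = Y w' - t * X w' := le_antisymm (hmin _ hw') (hmin' _ hw)
  have hXne : X w ≠ X w' := by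
    intro h
    rw [h] at heq
    have : (Y w : ℝ) = Y w' := by linarith
    have : Y w = Y w' := by exact_mod_cast this
    tauto
  wlog hX : X w < X w' generalizing w w'
  · exact this w' w hw' hw (by rcases hne with h | h <;> [left; right] <;> exact h.symm) hmin' hmin heq.symm hXne.symm (by omega)
  obtain ⟨q2, hq2, hq2a, hq2b⟩ := lemRed L N hN hlin h10 hy hB
  obtain ⟨q1, hq1, hq1a, hq1b⟩ := lemRed (fun x y => L y x) N hN
    (fun x y x' y' k h h' => hlin _ _ _ _ _ h h') h01 hx hA
  have hneg : ∀ x y, L x y → L (-x) (-y) := by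
    intro x y h
    have := hlin _ _ _ _ (-2) h h
    convert this using 1 <;> ring
  have q1R : (1:ℝ) ≤ q1 := by exact_mod_cast hq1a
  have q2R : (1:ℝ) ≤ q2 := by exact_mod_cast hq2a
  have q1R' : (q1:ℝ) ≤ N - 1 := by exact_mod_cast (by omega : q1 ≤ N - 1)
  have q2R' : (q2:ℝ) ≤ N - 1 := by exact_mod_cast (by omega : q2 ≤ N - 1)
  -- special lattice points
  have L1 : L (q2 - N) 1 := by
    have := hlin _ _ _ _ (-1) hq2 h10
    convert this using 1 <;> ring
  have L2 : L (-q2) (N - 1) := by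
    have := hlin _ _ _ _ (1) (hneg _ _ hq2) h01
    convert this using 1 <;> ring
  have L3 : L (N - q2) (N - 1) := by
    have := hlin _ _ _ _ (1) L2 h10
    convert this using 1 <;> ring
  have L4 : L 1 (q1 - N) := by
    have := hlin _ _ _ _ (-1) hq1 h01
    convert this using 1 <;> ring
  have L5 : L (N - 1) (-q1) := by
    have := hlin _ _ _ _ (1) (hneg _ _ hq1) h10
    convert this using 1 <;> ring
  have i0 := hRs _ _ hq2 (by omega) (by omega) (by omega)
  have i1 := hLs _ _ L1 (by omega) (by omega) (by omega)
  have i2 := hLs _ _ L2 (by omega) (by omega) (by omega)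
  have i3 := hRs _ _ L3 (by omega) (by omega) (by omega)
  have i4 := hT _ _ L4 (by omega) (by omega) (by omega)
  have i5 := hT _ _ L5 (by omega) (by omega) (by omega)
  push_cast at i0 i1 i2 i3 i4 i5
  have rr : r + r' < N := by linarith
  have c1 : s * N + r < N := by
    by_contra hc
    push Not at hc
    nlinarith
  have c2 : -N < s' * N - r' := by
    by_contra hc
    push Not at hc
    nlinarith
  have c3 : ρ < N := by
    by_contra hc
    push Not at hc
    nlinarith
  have c4 : ρ - t * N < N := by
    by_contra hc
    push Not at hc
    nlinarith
  have t1 : t < 1 := by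
    by_contra hc
    push Not at hc
    nlinarith
  have t2 : -1 < t := by
    by_contra hc
    push Not at hc
    nlinarith
  -- minimizers lie below
  have below : ∀ u ∈ V, (∀ i ∈ V, (Y u : ℝ) - t * X u ≤ Y i - t * X i) → (Y u : ℝ) ≤ 0 := by
    intro u hu hum
    rcases hdich u hu with h | h
    · exact_mod_cast h
    exfalso
    have hY : (N:ℝ) ≤ Y u := by exact_mod_cast h
    have f0 := hum j0 hj0
    rw [e0x, e0y] at f0
    simp only [Int.cast_zero, mul_zero, sub_zero] at f0
    have a1 := hR u hu
    have a2 := hLf u hu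
    have b1 : (X u : ℝ) < Y u := by
      have : (s * Y u + r) * N < Y u * N := by nlinarith [mul_nonneg hr (sub_nonneg.2 hY)]
      have := lt_of_mul_lt_mul_right this hN0.le
      linarith
    have b2 : -(Y u : ℝ) < X u := by
      have : (-(Y u:ℝ)) * N < (s' * Y u - r') * N := by nlinarith [mul_nonneg hr' (sub_nonneg.2 hY)]
      have := lt_of_mul_lt_mul_right this hN0.le
      linarith
    have b3 : |(X u : ℝ)| < Y u := abs_lt.2 ⟨b2, b1⟩
    have b4 : |t| < 1 := abs_lt.2 ⟨t2, t1⟩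
    have b5 : t * X u ≤ |t| * |(X u : ℝ)| := by rw [← abs_mul]; exact le_abs_self _
    have b6 : |t| * |(X u : ℝ)| ≤ |(X u : ℝ)| := mul_le_of_le_one_left (abs_nonneg _) b4.le
    linarith
  have wb := below w hw hmin
  have wb' := below w' hw' hmin'
  obtain ⟨dx, hdx⟩ : ∃ d, d = X w' - X w := ⟨_, rfl⟩
  obtain ⟨dy, hdy⟩ : ∃ d, d = Y w' - Y w := ⟨_, rfl⟩
  have hd : L dx dy := by
    have := hlin _ _ _ _ (-1) (hVL _ hw') (hVL _ hw)
    convert this using 1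
    · rw [hdx]; ring
    · rw [hdy]; ring
  have hdxR : (dx:ℝ) = X w' - X w := by rw [hdx]; push_cast; ring
  have hdyR : (dy:ℝ) = Y w' - Y w := by rw [hdy]; push_cast; ring
  have hdt : (dy:ℝ) = t * dx := by rw [hdxR, hdyR]; linarith
  have hdpos : 0 < dx := by omega
  have hdN : N ≤ dx := by
    by_contra hc
    push Not at hc
    obtain ⟨j, hj⟩ : ∃ j, j = (-xp) / dx + 1 := ⟨_, rfl⟩
    have m1 := Int.emod_add_mul_ediv (-xp) dx
    have m2 := Int.emod_nonneg (-xp) hdpos.ne'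
    have m3 := Int.emod_lt_of_pos (-xp) hdpos
    have hx1 : xp + j * dx = dx - (-xp) % dx := by rw [hj]; linarith
    have hl := hlin _ _ _ _ j hp hd
    have g1 : 0 < xp + j * dx := by omega
    have g2 : xp + j * dx < N := by omega
    have hline : ((yp + j * dy : ℤ) : ℝ) = t * ((xp + j * dx : ℤ) : ℝ) - ρ := by
      push_cast; rw [hyp, hdt]; ring
    have g1R : (0:ℝ) < ((xp + j * dx : ℤ) : ℝ) := by exact_mod_cast g1
    have g2R : ((xp + j * dx : ℤ) : ℝ) < N := by exact_mod_cast g2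
    generalize xp + j * dx = x0 at *
    generalize yp + j * dy = y0 at *
    have hy0 : ¬ y0 < 0 := by
      intro h
      have := hT _ _ hl g1 g2 h
      linarith
    have hle : (y0:ℝ) ≤ 0 := by
      rw [hline]
      have : (t * x0 - ρ) * N ≤ 0 := by
        nlinarith [mul_nonneg hρ (sub_nonneg.2 g2R.le), mul_nonneg (sub_nonneg.2 htρ) g1R.le]
      exact nonpos_of_mul_nonpos_left this hN0
    have hle' : y0 ≤ 0 := by exact_mod_cast hle
    have : y0 = 0 := by omega
    subst this
    have := Int.le_of_dvd g1 (hx _ hl)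
    omega
  have k1 : (dx:ℝ) < s * dy + N := by
    have := hR w' hw'
    have := hLf w hw
    rw [hdxR, hdyR]
    nlinarith
  have k2 : (dx:ℝ) < s' * dy + N := by
    have := hR w' hw'
    have := hLf w hw
    rw [hdxR, hdyR]
    nlinarith
  rcases lt_trichotomy t 0 with ht | ht | ht
  · refine lemB (fun x y => L (-x) y) N hN ?_ ?_ ?_ ?_ ?_ ?_ ?_ (-s') (-t) (by linarith) ?_ ?_ dx (-dy) ?_ ?_ hdN ?_
    · intro x y x' y' k h h'
      have := hlin _ _ _ _ k h h'
      convert this using 1; ring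
    · simpa using hneg _ _ h10
    · simpa using h01
    · intro x h
      simpa using hx _ h
    · intro y h
      exact hy y (by simpa using h)
    · exact ⟨-q1, hneg _ _ hq1⟩
    · exact ⟨-q2, by simpa using hq2⟩
    · intro x y h h1 h2 h3
      have := hLs _ _ h h1 h2 (by omega)
      push_cast at this
      linarith
    · intro x y h h1 h2 h3
      have h' := hneg _ _ h
      rw [neg_neg] at h'
      have := hT _ _ h' h1 h2 (by omega)
      push_cast at this
      linarith
    · exact hneg _ _ hd
    · push_cast; rw [hdt]; ring
    · push_cast; linarith
  · rw [ht] at hdt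
    have : (N:ℝ) ≤ dx := by exact_mod_cast hdN
    rw [hdt] at k1
    simp at k1
    have : (dx:ℝ) < N := by exact_mod_cast k1
    linarith
  · refine lemB L N hN hlin h10 h01 hx hy hA hB s t ht ?_ ?_ dx dy hd hdt hdN k1
    · intro x y h h1 h2 h3
      have := hRs _ _ h h1 h2 h3
      linarith
    · intro x y h h1 h2 h3
      have h' := hlin _ _ _ _ 1 (hneg _ _ h) h10
      have := hT _ _ h' (by omega) (by omega) (by omega)
      push_cast at this
      linarith

set_option maxHeartbeats 1000000 in
theorem lemCore {ι κ : Type*} (VQ : Finset ι) (XQ YQ : ι → ℤ) (VP : Finset κ) (XP YP : κ → ℤ)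
    (L : ℤ → ℤ → Prop) (N : ℤ) (hN : 2 ≤ N)
    (hlin : ∀ x y x' y' k, L x y → L x' y' → L (x + k * x') (y + k * y'))
    (h10 : L N 0) (h01 : L 0 N) (hx : ∀ x, L x 0 → N ∣ x) (hy : ∀ y, L 0 y → N ∣ y)
    (hA : ∃ q, L 1 q) (hB : ∃ q, L q 1)
    (hQL : ∀ i ∈ VQ, L (XQ i) (YQ i)) (hPL : ∀ i ∈ VP, L (XP i) (YP i))
    (CQ CP : ℝ → ℝ → Prop)
    (hCQ : ∀ x y x' y' a b : ℝ, CQ x y → CQ x' y' → 0 ≤ a → 0 ≤ b → a + b = 1 →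
      CQ (a * x + b * x') (a * y + b * y'))
    (hCP : ∀ x y x' y' a b : ℝ, CP x y → CP x' y' → 0 ≤ a → 0 ≤ b → a + b = 1 →
      CP (a * x + b * x') (a * y + b * y'))
    (hQC : ∀ i ∈ VQ, CQ (XQ i) (YQ i)) (hPC : ∀ i ∈ VP, CP (XP i) (YP i))
    (j0 j1 : ι) (hj0 : j0 ∈ VQ) (hj1 : j1 ∈ VQ)
    (j00 : XQ j0 = 0) (j01 : YQ j0 = 0) (j10 : XQ j1 = 0) (j11 : YQ j1 = N)
    (i0 i1 : κ) (hi0 : i0 ∈ VP) (hi1 : i1 ∈ VP)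
    (i00 : XP i0 = 0) (i01 : YP i0 = 0) (i10 : XP i1 = N) (i11 : YP i1 = 0)
    (hnoQ : ∀ x y : ℤ, L x y → CQ x y → 0 < y → y < N → |x| < N → False)
    (hnoP : ∀ x y : ℤ, L x y → CP x y → 0 < x → x < N → |y| < N → False)
    (hface : ∀ α β : ℝ, ∀ p ∈ VP, ∀ p' ∈ VP, XP p ≠ XP p' →
      (∀ i ∈ VP, α * XP p + β * YP p ≤ α * XP i + β * YP i) →
      (∀ i ∈ VP, α * XP p' + β * YP p' ≤ α * XP i + β * YP i) →
      ∃ w ∈ VQ, ∃ w' ∈ VQ, (XQ w ≠ XQ w' ∨ YQ w ≠ YQ w') ∧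
      (∀ i ∈ VQ, α * XQ w + β * YQ w ≤ α * XQ i + β * YQ i) ∧
      (∀ i ∈ VQ, α * XQ w' + β * YQ w' ≤ α * XQ i + β * YQ i)) : False := by
  have hneg : ∀ x y, L x y → L (-x) (-y) := by
    intro x y h
    have := hlin _ _ _ _ (-2) h h
    convert this using 1 <;> ring
  have hN0 : 0 < N := by omega
  obtain ⟨hdich, s, r, hR, -, hRs⟩ := lemLine VQ XQ YQ L N hN0
    (fun x y k h => by simpa using hlin _ _ _ _ k h h10) hQL CQ hCQ hQC j0 j1 hj0 hj1
    j00 j01 j10 j11 hnoQ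
  obtain ⟨-, s2, r2, hR2, -, hRs2⟩ := lemLine VQ (fun i => - XQ i) YQ (fun x y => L (-x) y) N hN0
    (fun x y k h => by
      have := hlin _ _ _ _ (-k) h h10
      convert this using 1 <;> ring)
    (by intro i hi; simpa using hQL i hi) (fun x y => CQ (-x) y)
    (by
      intro x y x' y' a b h h' ha hb hab
      have := hCQ _ _ _ _ a b h h' ha hb hab
      convert this using 1; ring)
    (by intro i hi; simpa using hQC i hi) j0 j1 hj0 hj1
    (by simpa using j00) j01 (by simpa using j10) j11
    (by
      intro x y h1 h2 h3 h4 h5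
      exact hnoQ (-x) y h1 (by push_cast; exact h2) h3 h4 (by rwa [abs_neg]))
  obtain ⟨-, s3, r3, hR3, ⟨p3, hp3, p3', hp3', b3, b3', e3, e3'⟩, hRs3⟩ :=
    lemLine VP (fun i => - YP i) XP (fun x y => L y (-x)) N hN0
    (fun x y k h => by
      have := hlin _ _ _ _ (-k) h h01
      convert this using 1 <;> ring)
    (by intro i hi; simpa using hPL i hi) (fun x y => CP y (-x))
    (by
      intro x y x' y' a b h h' ha hb hab
      have := hCP _ _ _ _ a b h h' ha hb hab
      convert this using 1; ring)
    (by intro i hi; simpa using hPC i hi) i0 i1 hi0 hi1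
    (by simpa using i01) i00 (by simpa using i11) i10
    (by
      intro x y h1 h2 h3 h4 h5
      exact hnoP y (-x) h1 (by push_cast; exact h2) h3 h4 (by rwa [abs_neg]))
  obtain ⟨-, s4, r4, hR4, ⟨p4, hp4, p4', hp4', b4, b4', e4, e4'⟩, hRs4⟩ :=
    lemLine VP YP XP (fun x y => L y x) N hN0
    (fun x y k h => by
      have := hlin _ _ _ _ k h h01
      convert this using 1 <;> ring)
    (by intro i hi; simpa using hPL i hi) (fun x y => CP y x)
    (by
      intro x y x' y' a b h h' ha hb hab
      exact hCP _ _ _ _ a b h h' ha hb hab)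
    (by intro i hi; simpa using hPC i hi) i0 i1 hi0 hi1
    i01 i00 i11 i10
    (by
      intro x y h1 h2 h3 h4 h5
      exact hnoP y x h1 h2 h3 h4 h5)
  push_cast at hR2 hR3 e3 e3'
  have r1a := hR j0 hj0
  have r1b := hR j1 hj1
  have r2a := hR2 j0 hj0
  have r2b := hR2 j1 hj1
  have r3a := hR3 i0 hi0
  have r3b := hR3 i1 hi1
  have r4a := hR4 i0 hi0
  have r4b := hR4 i1 hi1
  rw [j00, j01] at r1a r2a
  rw [j10, j11] at r1b r2b
  rw [i00, i01] at r3a r4a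
  rw [i10, i11] at r3b r4b
  push_cast at r1a r1b r2a r2b r3a r3b r4a r4b
  simp only [mul_zero, zero_add, neg_zero] at r1a r1b r2a r2b r3a r3b r4a r4b
  rcases le_total (-s2) s with hss | hss
  · obtain ⟨w, hw, w', hw', hne, hm, hm'⟩ := hface s3 1 p3 hp3 p3' hp3' (by omega)
      (by intro i hi; have := hR3 i hi; linarith)
      (by intro i hi; have := hR3 i hi; linarith)
    refine lemA VQ XQ YQ L N hN hlin h10 h01 hx hy hA hB hQL hdich j0 hj0 j00 j01 s r (-s2) r2
      r1a r1b r2a (by linarith) hR ?_ hRs ?_ hss (-s3) r3 r3a (by linarith) ?_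
      (XP p3) (YP p3) (hPL _ hp3) b3 (by linarith) w w' hw hw' hne ?_ ?_
    · intro i hi; have := hR2 i hi; linarith
    · intro x y h h1 h2 h3
      have := hRs2 (-x) y (by simpa using h) h1 h2 (by omega)
      push_cast at this; linarith
    · intro x y h h1 h2 h3
      have := hRs3 (-y) x (by simpa using h) h1 h2 (by omega)
      push_cast at this; linarith
    · intro i hi; have := hm i hi; linarith
    · intro i hi; have := hm' i hi; linarith
  · obtain ⟨w, hw, w', hw', hne, hm, hm'⟩ := hface s4 (-1) p4 hp4 p4' hp4' (by omega)
      (by intro i hi; have := hR4 i hi; linarith)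
      (by intro i hi; have := hR4 i hi; linarith)
    refine lemA VQ (fun i => - XQ i) (fun i => N - YQ i) L N hN hlin h10 h01 hx hy hA hB
      ?_ ?_ j1 hj1 (by simp [j10]) (by simp [j11]) (-s2) (r2 + s2 * N) s (r + s * N)
      (by linarith) (by linarith) (by linarith) (by linarith) ?_ ?_ ?_ ?_ hss
      s4 (r4 + s4 * N) (by linarith) (by linarith) ?_
      (N - XP p4') (- YP p4') ?_ (by omega) ?_ w w' hw hw' (by omega) ?_ ?_
    · intro i hi
      have := hlin _ _ _ _ 1 (hneg _ _ (hQL i hi)) h01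
      convert this using 1 <;> ring
    · intro i hi
      have := hdich i hi
      omega
    · intro i hi; have := hR2 i hi; push_cast; linarith
    · intro i hi; have := hR i hi; push_cast; linarith
    · intro x y h h1 h2 h3
      have h' := hlin _ _ _ _ 1 (hneg _ _ h) h01
      have := hRs2 x (N - y) (by convert h' using 1 <;> ring) (by omega) (by omega) (by omega)
      push_cast at this; linarith
    · intro x y h h1 h2 h3
      have h' := hlin _ _ _ _ 1 (hneg _ _ h) h01
      have := hRs (-x) (N - y) (by convert h' using 1 <;> ring) (by omega) (by omega) (by omega)
      push_cast at this; linarith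
    · intro x y h h1 h2 h3
      have h' := hlin _ _ _ _ 1 (hneg _ _ h) h10
      have := hRs4 (-y) (N - x) (by convert h' using 1 <;> ring) (by omega) (by omega) (by omega)
      push_cast at this; linarith
    · have := hlin _ _ _ _ 1 (hneg _ _ (hPL _ hp4')) h10
      convert this using 1 <;> ring
    · push_cast; linarith
    · intro i hi; have := hm i hi; push_cast; linarith
    · intro i hi; have := hm' i hi; push_cast; linarith

def FaceProp (VP VQ : Finset (Fin 2 → ℤ)) : Prop :=
  ∀ α β : ℝ, ∀ p ∈ VP, ∀ p' ∈ VP, p ≠ p' →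
    (∀ i ∈ VP, α * p 0 + β * p 1 ≤ α * i 0 + β * i 1) →
    (∀ i ∈ VP, α * p' 0 + β * p' 1 ≤ α * i 0 + β * i 1) →
    ∃ w ∈ VQ, ∃ w' ∈ VQ, w ≠ w' ∧
    (∀ i ∈ VQ, α * w 0 + β * w 1 ≤ α * i 0 + β * i 1) ∧
    (∀ i ∈ VQ, α * w' 0 + β * w' 1 ≤ α * i 0 + β * i 1)

theorem lemFace (P Q : Set (Fin 2 → ℝ)) (VP VQ : Finset (Fin 2 → ℤ)) (hVQ : VQ.Nonempty)
    (hP : P = convexHull ℝ (toR2 '' ↑VP)) (hQ : Q = convexHull ℝ (toR2 '' ↑VQ))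
    (h : IsWeakMinkowskiSummand P Q) : FaceProp VP VQ := by
  obtain ⟨P', ⟨V', hV', rfl⟩, k, hk, hsum⟩ := h
  intro α β p hp p' hp' hne hm hm'
  let f : (Fin 2 → ℝ) → ℝ := fun z => α * z 0 + β * z 1
  have fadd : ∀ x y, f (x + y) = f x + f y := by intro x y; simp only [f, Pi.add_apply]; ring
  have fsmul : ∀ (c : ℝ) y, f (c • y) = c * f y := by
    intro x y; simp only [f, Pi.smul_apply, smul_eq_mul]; ring
  have flin : IsLinearMap ℝ f := ⟨fadd, fun c y => by rw [fsmul]; rfl⟩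
  obtain ⟨w, hw, hwm⟩ := Finset.exists_min_image VQ (fun c => f (toR2 c)) hVQ
  obtain ⟨m, hmV, hmm⟩ := Finset.exists_min_image V' f hV'
  by_contra hcon
  push Not at hcon
  have huniq : ∀ w' ∈ VQ, w' ≠ w → f (toR2 w) < f (toR2 w') := by
    intro w' hw' hne'
    by_contra hc
    push Not at hc
    obtain ⟨i, hi, hlt⟩ := hcon w hw w' hw' hne'.symm (fun i hi => hwm i hi)
    have := hwm i hi
    simp only [f, toR2] at this hc
    linarith
  have hconv : Convex ℝ ({z | f (toR2 w) < f z} ∪ {toR2 w}) := by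
    intro x hx y hy a b ha hb hab
    rcases ha.eq_or_lt with rfl | ha'
    · have : b = 1 := by linarith
      subst this; simpa using hy
    rcases hb.eq_or_lt with rfl | hb'
    · have : a = 1 := by linarith
      subst this; simpa using hx
    have e : f (a • x + b • y) = a * f x + b * f y := by rw [fadd, fsmul, fsmul]
    have hb1 : b = 1 - a := by linarith
    rcases hx with hx | hx
    · left
      have hx' : f (toR2 w) < f x := hx
      have hy' : f (toR2 w) ≤ f y := by
        rcases hy with hy | hy
        · exact le_of_lt hy
        · rw [Set.mem_singleton_iff.1 hy]
      show f (toR2 w) < f (a • x + b • y)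
      rw [e]
      have : f (toR2 w) = a * f (toR2 w) + b * f (toR2 w) := by rw [← add_mul, hab, one_mul]
      nlinarith
    · rcases hy with hy | hy
      · left
        have hy' : f (toR2 w) < f y := hy
        show f (toR2 w) < f (a • x + b • y)
        rw [e, Set.mem_singleton_iff.1 hx]
        have : f (toR2 w) = a * f (toR2 w) + b * f (toR2 w) := by rw [← add_mul, hab, one_mul]
        nlinarith
      · right
        rw [Set.mem_singleton_iff.1 hx, Set.mem_singleton_iff.1 hy, ← add_smul, hab, one_smul]
        rfl
  have hsub : Q ⊆ {z | f (toR2 w) < f z} ∪ {toR2 w} := by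
    rw [hQ]
    apply convexHull_min _ hconv
    rintro _ ⟨c, hc, rfl⟩
    by_cases hcw : c = w
    · right; rw [hcw]; rfl
    · left; exact huniq c hc hcw
  have hPmin : ∀ z ∈ P, f (toR2 p) ≤ f z := by
    have : P ⊆ {z | f (toR2 p) ≤ f z} := by
      rw [hP]
      apply convexHull_min _ (convex_halfSpace_ge flin _)
      rintro _ ⟨c, hc, rfl⟩
      exact hm c hc
    exact this
  have hP'min : ∀ z ∈ convexHull ℝ (V' : Set (Fin 2 → ℝ)), f m ≤ f z := by
    have : convexHull ℝ (V' : Set (Fin 2 → ℝ)) ⊆ {z | f m ≤ f z} := by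
      apply convexHull_min _ (convex_halfSpace_ge flin _)
      intro c hc
      exact hmm c hc
    exact this
  have hwQ : toR2 w ∈ Q := by rw [hQ]; exact subset_convexHull _ _ ⟨w, hw, rfl⟩
  have hkw : f (toR2 p) + f m ≤ k * f (toR2 w) := by
    have : k • toR2 w ∈ P + convexHull ℝ (V' : Set (Fin 2 → ℝ)) := by
      rw [hsum]; exact Set.smul_mem_smul_set hwQ
    obtain ⟨z1, h1, z2, h2, h12⟩ := Set.mem_add.1 this
    rw [← fsmul, ← h12, fadd]
    exact add_le_add (hPmin _ h1) (hP'min _ h2)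
  have hpp : ∀ z ∈ VP, f (toR2 z) = f (toR2 p) → toR2 z + m = k • toR2 w := by
    intro z hz hfz
    have hzP : toR2 z ∈ P := by rw [hP]; exact subset_convexHull _ _ ⟨z, hz, rfl⟩
    have : toR2 z + m ∈ k • Q := by
      rw [← hsum]
      exact Set.add_mem_add hzP (subset_convexHull _ _ hmV)
    obtain ⟨q, hq, hqe⟩ := Set.mem_smul_set.1 this
    rcases hsub hq with h1 | h1
    · exfalso
      have h1' : f (toR2 w) < f q := h1
      have : k * f q = f (toR2 p) + f m := by rw [← fsmul, hqe, fadd, hfz]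
      nlinarith
    · rw [← hqe, Set.mem_singleton_iff.1 h1]
  have e1 := hpp p hp rfl
  have e2 := hpp p' hp' (le_antisymm (hm' p hp) (hm p' hp'))
  apply hne
  have : toR2 p = toR2 p' := by
    rw [← e2] at e1
    exact add_right_cancel e1
  funext i
  have := congrFun this i
  simpa [toR2] using this

theorem lemPrim (P : Set (Fin 2 → ℝ)) (hP : Convex ℝ P) (a0 u : Fin 2 → ℤ)
    (h0 : toR2 a0 ∈ P) (h1 : toR2 (a0 + u) ∈ P) (N e f : ℤ) (hN : N = u 0 * e - u 1 * f)
    (hN0 : 0 < N)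
    (star : ∀ c : Fin 2 → ℤ, toR2 c ∈ P → ∀ x : ℤ, (∀ i, N * (c i - a0 i) = x * u i) →
      0 < x → x < N → False) : IsCoprime (u 0) (u 1) := by
  rw [Int.isCoprime_iff_gcd_eq_one]
  by_contra hg
  obtain ⟨d, hd⟩ : ∃ d : ℤ, d = Int.gcd (u 0) (u 1) := ⟨_, rfl⟩
  have hd0 : 0 ≤ d := by rw [hd]; positivity
  have hd1 : d ≠ 1 := by rw [hd]; exact_mod_cast hg
  obtain ⟨p, hp⟩ : d ∣ u 0 := by rw [hd]; exact Int.gcd_dvd_left ..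
  obtain ⟨q, hq⟩ : d ∣ u 1 := by rw [hd]; exact Int.gcd_dvd_right ..
  have hNd : N = d * (p * e - q * f) := by rw [hN, hp, hq]; ring
  have hdz : d ≠ 0 := by rintro rfl; simp at hNd; omega
  have hd2 : 2 ≤ d := by omega
  have hm : 0 < p * e - q * f := by
    by_contra hc
    nlinarith
  have hdR : (0:ℝ) < d := by exact_mod_cast (by omega : 0 < d)
  have hd1R : (1:ℝ) ≤ d := by exact_mod_cast (by omega : 1 ≤ d)
  refine star (a0 + ![p, q]) ?_ (p * e - q * f) ?_ hm (by nlinarith)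
  · have := hP h0 h1 (a := 1 - 1 / d) (b := 1 / d)
      (by rw [sub_nonneg, div_le_one hdR]; exact hd1R) (by positivity) (by ring)
    convert this using 1
    funext i
    fin_cases i
    · simp [toR2, hp]; field_simp; ring
    · simp [toR2, hq]; field_simp; ring
  · intro i
    fin_cases i
    · simp [hp]; rw [hNd]; ring
    · simp [hq]; rw [hNd]; ring

set_option maxHeartbeats 1000000 in
theorem lem22 (P Q : Set (Fin 2 → ℝ)) (VP VQ : Finset (Fin 2 → ℤ))
    (hP : P = convexHull ℝ (toR2 '' ↑VP)) (hQ : Q = convexHull ℝ (toR2 '' ↑VQ))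
    (hface : FaceProp VP VQ) (a0 b0 u w : Fin 2 → ℤ)
    (ha0 : a0 ∈ VP) (ha1 : a0 + u ∈ VP) (hb0 : b0 ∈ VQ) (hb1 : b0 + w ∈ VQ)
    (N : ℤ) (hN : N = u 0 * w 1 - u 1 * w 0) (hN2 : 2 ≤ N)
    (starQ : ∀ c : Fin 2 → ℤ, toR2 c ∈ Q → ∀ x y : ℤ,
      (∀ i, N * (c i - b0 i) = x * u i + y * w i) → 0 < y → y < N → |x| < N → False)
    (starP : ∀ c : Fin 2 → ℤ, toR2 c ∈ P → ∀ x y : ℤ,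
      (∀ i, N * (c i - a0 i) = x * u i + y * w i) → 0 < x → x < N → |y| < N → False) :
    False := by
  have hPc : Convex ℝ P := by rw [hP]; exact convex_convexHull _ _
  have hQc : Convex ℝ Q := by rw [hQ]; exact convex_convexHull _ _
  have hPm : ∀ c ∈ VP, toR2 c ∈ P := by
    intro c hc; rw [hP]; exact subset_convexHull _ _ ⟨c, hc, rfl⟩
  have hQm : ∀ c ∈ VQ, toR2 c ∈ Q := by
    intro c hc; rw [hQ]; exact subset_convexHull _ _ ⟨c, hc, rfl⟩
  have hu : IsCoprime (u 0) (u 1) := lemPrim P hPc a0 u (hPm _ ha0) (hPm _ ha1) N (w 1) (w 0) hN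
    (by omega) (fun c hc x h h1 h2 => starP c hc x 0 (by simpa using h) h1 h2 (by simp; omega))
  have hw : IsCoprime (w 0) (w 1) := lemPrim Q hQc b0 w (hQm _ hb0) (hQm _ hb1) N (-u 1) (-u 0)
    (by rw [hN]; ring)
    (by omega) (fun c hc x h h1 h2 => starQ c hc 0 x (by simpa using h) h1 h2 (by simp; omega))
  have hNR : (0:ℝ) < N := by exact_mod_cast (by omega : 0 < N)
  have hNR' : (N:ℝ) = u 0 * w 1 - u 1 * w 0 := by rw [hN]; push_cast; ring
  have convC : ∀ (S : Set (Fin 2 → ℝ)) (o : Fin 2 → ℤ), Convex ℝ S →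
      ∀ x y x' y' a b : ℝ, (fun i => o i + (x * u i + y * w i) / N) ∈ S →
      (fun i => o i + (x' * u i + y' * w i) / N) ∈ S → 0 ≤ a → 0 ≤ b → a + b = 1 →
      (fun i => o i + ((a * x + b * x') * u i + (a * y + b * y') * w i) / N) ∈ S := by
    intro S o hS x y x' y' a b h h' ha hb hab
    have := hS h h' ha hb hab
    convert this using 1
    funext i
    simp only [Pi.add_apply, Pi.smul_apply, smul_eq_mul]
    have : b = 1 - a := by linarith
    subst this
    field_simp
    ring
  have memC : ∀ (S : Set (Fin 2 → ℝ)) (o c : Fin 2 → ℤ), toR2 c ∈ S →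
      (fun i => (o i : ℝ) + ((((c 0 - o 0) * w 1 - (c 1 - o 1) * w 0 : ℤ) : ℝ) * u i +
        ((u 0 * (c 1 - o 1) - u 1 * (c 0 - o 0) : ℤ) : ℝ) * w i) / N) ∈ S := by
    intro S o c h
    convert h using 1
    funext i
    have : ((((c 0 - o 0) * w 1 - (c 1 - o 1) * w 0 : ℤ) : ℝ) * u i +
        ((u 0 * (c 1 - o 1) - u 1 * (c 0 - o 0) : ℤ) : ℝ) * w i) = (c i - o i) * N := by
      rw [hNR']
      push_cast
      fin_cases i <;> simp <;> ring
    rw [this, mul_div_assoc, div_self hNR.ne']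
    simp [toR2]
  have noC : ∀ (S : Set (Fin 2 → ℝ)) (o : Fin 2 → ℤ) (x y : ℤ),
      (∃ c d : ℤ, x = c * w 1 - d * w 0 ∧ y = u 0 * d - u 1 * c) →
      (fun i => (o i : ℝ) + (x * u i + y * w i) / N) ∈ S → ∃ c : Fin 2 → ℤ, toR2 c ∈ S ∧
        ∀ i, N * (c i - o i) = x * u i + y * w i := by
    rintro S o x y ⟨c, d, hx, hy⟩ h
    have key : ∀ i, N * ((o + ![c, d]) i - o i) = x * u i + y * w i := by
      intro i
      rw [hx, hy, hN]
      fin_cases i <;> simp <;> ring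
    refine ⟨o + ![c, d], ?_, key⟩
    convert h using 1
    funext i
    have := key i
    have : (N:ℝ) * (((o + ![c, d]) i : ℤ) - o i) = x * u i + y * w i := by exact_mod_cast this
    rw [← this]
    simp only [toR2]
    field_simp
    ring
  refine lemCore VQ (fun c => (c 0 - b0 0) * w 1 - (c 1 - b0 1) * w 0)
    (fun c => u 0 * (c 1 - b0 1) - u 1 * (c 0 - b0 0)) VP
    (fun c => (c 0 - a0 0) * w 1 - (c 1 - a0 1) * w 0)
    (fun c => u 0 * (c 1 - a0 1) - u 1 * (c 0 - a0 0))
    (fun x y => ∃ c d : ℤ, x = c * w 1 - d * w 0 ∧ y = u 0 * d - u 1 * c) N hN2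
    ?_ ⟨u 0, u 1, by rw [hN], by ring⟩ ⟨w 0, w 1, by ring, by rw [hN]⟩ ?_ ?_ ?_ ?_
    (fun i _ => ⟨i 0 - b0 0, i 1 - b0 1, rfl, rfl⟩) (fun i _ => ⟨i 0 - a0 0, i 1 - a0 1, rfl, rfl⟩)
    (fun x y => (fun i => (b0 i : ℝ) + (x * u i + y * w i) / N) ∈ Q)
    (fun x y => (fun i => (a0 i : ℝ) + (x * u i + y * w i) / N) ∈ P)
    (convC Q b0 hQc) (convC P a0 hPc) (fun c hc => memC Q b0 c (hQm c hc))
    (fun c hc => memC P a0 c (hPm c hc)) b0 (b0 + w) hb0 hb1 (by simp) (by simp)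
    (by simp; ring) (by simp [hN]) a0 (a0 + u) ha0 ha1 (by simp) (by simp)
    (by simp [hN]) (by simp; ring) ?_ ?_ ?_
  · rintro x y x' y' k ⟨c, d, rfl, rfl⟩ ⟨c', d', rfl, rfl⟩
    exact ⟨c + k * c', d + k * d', by ring, by ring⟩
  · rintro x ⟨c, d, rfl, h⟩
    have : u 0 ∣ c := by
      apply hu.dvd_of_dvd_mul_left
      exact ⟨d, by linarith⟩
    obtain ⟨k, rfl⟩ := this
    have hd : u 1 ∣ d := by
      apply hu.symm.dvd_of_dvd_mul_left
      exact ⟨u 0 * k, by linarith⟩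
    obtain ⟨l, rfl⟩ := hd
    by_cases h0 : u 0 = 0
    · refine ⟨l, ?_⟩
      rw [hN, h0]; ring
    · by_cases h1 : u 1 = 0
      · refine ⟨k, ?_⟩
        rw [hN, h1]; ring
      · have : u 0 * u 1 * (l - k) = 0 := by linarith
        have hlk : l = k := by
          rcases mul_eq_zero.1 this with h' | h'
          · exact absurd h' (mul_ne_zero h0 h1)
          · omega
        refine ⟨k, ?_⟩
        rw [hN, hlk]; ring
  · rintro y ⟨c, d, h, rfl⟩
    have : w 0 ∣ c := by
      apply hw.dvd_of_dvd_mul_left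
      exact ⟨d, by linarith⟩
    obtain ⟨k, rfl⟩ := this
    have hd : w 1 ∣ d := by
      apply hw.symm.dvd_of_dvd_mul_left
      exact ⟨w 0 * k, by linarith⟩
    obtain ⟨l, rfl⟩ := hd
    by_cases h0 : w 0 = 0
    · refine ⟨l, ?_⟩
      rw [hN, h0]; ring
    · by_cases h1 : w 1 = 0
      · refine ⟨k, ?_⟩
        rw [hN, h1]; ring
      · have : w 0 * w 1 * (l - k) = 0 := by linarith
        have hlk : l = k := by
          rcases mul_eq_zero.1 this with h' | h'
          · exact absurd h' (mul_ne_zero h0 h1)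
          · omega
        refine ⟨k, ?_⟩
        rw [hN, hlk]; ring
  · obtain ⟨p, q, h⟩ := hw
    exact ⟨_, q, -p, by linarith, rfl⟩
  · obtain ⟨p, q, h⟩ := hu
    exact ⟨_, -q, p, rfl, by linarith⟩
  · intro x y hL hC h1 h2 h3
    obtain ⟨c, hc, hc'⟩ := noC Q b0 x y hL hC
    exact starQ c hc x y hc' h1 h2 h3
  · intro x y hL hC h1 h2 h3
    obtain ⟨c, hc, hc'⟩ := noC P a0 x y hL hC
    exact starP c hc x y hc' h1 h2 h3
  · intro α β p hp p' hp' hne hm hm'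
    have hne' : p ≠ p' := by rintro rfl; exact hne rfl
    push_cast at hm hm' ⊢
    obtain ⟨z, hz, z', hz', hzne, hzm, hzm'⟩ := hface (α * w 1 - β * u 1) (β * u 0 - α * w 0)
      p hp p' hp' hne'
      (by intro i hi; have := hm i hi; linarith)
      (by intro i hi; have := hm' i hi; linarith)
    refine ⟨z, hz, z', hz', ?_, ?_, ?_⟩
    · by_contra hcon
      push Not at hcon
      obtain ⟨h1, h2⟩ := hcon
      apply hzne
      have e0 : N * (z 0 - z' 0) = 0 := by
        rw [hN]; linear_combination (u 0) * h1 + (w 0) * h2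
      have e1 : N * (z 1 - z' 1) = 0 := by
        rw [hN]; linear_combination (u 1) * h1 + (w 1) * h2
      have hNz : N ≠ 0 := by omega
      funext i
      fin_cases i
      · have := (mul_eq_zero.1 e0).resolve_left hNz
        simp; omega
      · have := (mul_eq_zero.1 e1).resolve_left hNz
        simp; omega
    · intro i hi; have := hzm i hi; linarith
    · intro i hi; have := hzm' i hi; linarith

theorem lem3 (P : Set (Fin 2 → ℝ)) (hPc : Convex ℝ P) (o u w : Fin 2 → ℤ)
    (h0 : toR2 o ∈ P) (h1 : toR2 (o + u) ∈ P) (h2 : toR2 (o + w) ∈ P)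
    (hN : u 0 * w 1 - u 1 * w 0 ≠ 0)
    (star : ∀ c : Fin 2 → ℤ, toR2 c ∈ P → ∀ x y : ℝ, (∀ i, (c i : ℝ) = o i + x * u i + y * w i) →
      x < 1 → y < 1 → 0 < x + y → False) : |u 0 * w 1 - u 1 * w 0| = 1 := by
  wlog hpos : 0 < u 0 * w 1 - u 1 * w 0 generalizing u w
  · have := this w u h2 h1 (by intro h; apply hN; linarith)
      (by
        intro c hc x y h hx hy hxy
        exact star c hc y x (by intro i; rw [h i]; ring) hy hx (by linarith))
      (by
        have : u 0 * w 1 - u 1 * w 0 < 0 := lt_of_le_of_ne (not_lt.1 hpos) hN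
        linarith)
    rw [← this, ← abs_neg]; congr 1; ring
  obtain ⟨N, hNe⟩ : ∃ N, N = u 0 * w 1 - u 1 * w 0 := ⟨_, rfl⟩
  rw [← hNe] at hpos ⊢
  rw [abs_of_pos hpos]
  by_contra hne
  have hN2 : 2 ≤ N := by omega
  have hNR : (0:ℝ) < N := by exact_mod_cast hpos
  obtain ⟨c, hc⟩ : ∃ c : Fin 2 → ℤ, ¬ (N ∣ c 0 * w 1 - c 1 * w 0 ∧ N ∣ u 0 * c 1 - u 1 * c 0) := by
    by_contra hcon
    push Not at hcon
    obtain ⟨⟨p, hp⟩, q, hq⟩ := hcon ![1, 0]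
    obtain ⟨⟨p', hp'⟩, q', hq'⟩ := hcon ![0, 1]
    simp at hp hq hp' hq'
    have hw0 : w 0 = -(N * p') := by linarith
    have hu1 : u 1 = -(N * q) := by linarith
    rw [hp, hq', hw0, hu1] at hNe
    have : N * 1 = N * (N * (q' * p - q * p')) := by linarith
    have := mul_left_cancel₀ hpos.ne' this
    have := Int.le_of_dvd (by norm_num) (Dvd.intro _ this.symm)
    omega
  obtain ⟨x, hx⟩ : ∃ x, x = c 0 * w 1 - c 1 * w 0 := ⟨_, rfl⟩
  obtain ⟨y, hy⟩ : ∃ y, y = u 0 * c 1 - u 1 * c 0 := ⟨_, rfl⟩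
  rw [← hx, ← hy] at hc
  have hc0 : N * c 0 = x * u 0 + y * w 0 := by rw [hx, hy, hNe]; ring
  have hc1 : N * c 1 = x * u 1 + y * w 1 := by rw [hx, hy, hNe]; ring
  have ex := Int.emod_add_mul_ediv x N
  have ey := Int.emod_add_mul_ediv y N
  have x1 := Int.emod_nonneg x hpos.ne'
  have y1 := Int.emod_nonneg y hpos.ne'
  have x2 := Int.emod_lt_of_pos x hpos
  have y2 := Int.emod_lt_of_pos y hpos
  have hxy : 0 < x % N + y % N := by
    by_contra hcon
    apply hc
    constructor <;> apply Int.dvd_of_emod_eq_zero <;> omega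
  have key : ∀ (d : Fin 2 → ℤ) (a b : ℤ), (∀ i, N * d i = a * u i + b * w i) → 0 ≤ a → 0 ≤ b →
      a < N → b < N → 0 < a + b → a + b ≤ N → False := by
    intro d a b hd ha hb ha' hb' h h'
    have haR : (0:ℝ) ≤ a := by exact_mod_cast ha
    have hbR : (0:ℝ) ≤ b := by exact_mod_cast hb
    have haR' : (a:ℝ) < N := by exact_mod_cast ha'
    have hbR' : (b:ℝ) < N := by exact_mod_cast hb'
    have hR : (0:ℝ) < a + b := by exact_mod_cast h
    have hR' : (a:ℝ) + b ≤ N := by exact_mod_cast h'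
    have hdR : ∀ i, (d i : ℝ) = a / N * u i + b / N * w i := by
      intro i
      have : (N:ℝ) * d i = a * u i + b * w i := by exact_mod_cast hd i
      field_simp
      linarith
    refine star (o + d) ?_ (a / N) (b / N) ?_ ((div_lt_one hNR).2 haR') ((div_lt_one hNR).2 hbR')
      (by rw [← add_div]; positivity)
    · have hm := hPc.sum_mem (t := (Finset.univ : Finset (Fin 3)))
        (w := (![1 - (a:ℝ) / N - b / N, (a:ℝ) / N, (b:ℝ) / N] : Fin 3 → ℝ)) (z := ![toR2 o, toR2 (o + u), toR2 (o + w)])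
        (by
          intro i _
          fin_cases i
          · simp only [Fin.zero_eta, Matrix.cons_val_zero]
            rw [sub_sub, ← add_div, sub_nonneg, div_le_one hNR]; exact hR'
          · simp; positivity
          · simp; positivity)
        (by simp [Fin.sum_univ_three]; try ring)
        (by intro i _; fin_cases i <;> simp [h0, h1, h2])
      convert hm using 1
      funext i
      simp [Fin.sum_univ_three, toR2, hdR i]
      ring
    · intro i
      simp [hdR i]
      ring
  by_cases hle : x % N + y % N ≤ N
  · refine key (fun i => c i - (x / N) * u i - (y / N) * w i) (x % N) (y % N) ?_ x1 y1 x2 y2 hxy hle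
    intro i
    fin_cases i
    · simp only [Fin.zero_eta]
      linear_combination hc0 - u 0 * ex - w 0 * ey
    · simp only [Fin.mk_one]
      linear_combination hc1 - u 1 * ex - w 1 * ey
  · refine key (fun i => u i + w i - (c i - (x / N) * u i - (y / N) * w i)) (N - x % N) (N - y % N)
      ?_ (by omega) (by omega) (by omega) (by omega) (by omega) (by omega)
    intro i
    fin_cases i
    · simp only [Fin.zero_eta]
      linear_combination -(hc0 - u 0 * ex - w 0 * ey)
    · simp only [Fin.mk_one]
      linear_combination -(hc1 - u 1 * ex - w 1 * ey)

theorem lem22' (P Q : Set (Fin 2 → ℝ)) (VP VQ : Finset (Fin 2 → ℤ)) (hVQ : VQ.Nonempty)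
    (hP : P = convexHull ℝ (toR2 '' ↑VP)) (hQ : Q = convexHull ℝ (toR2 '' ↑VQ))
    (hPQ : IsWeakMinkowskiSummand P Q) (a0 b0 u w : Fin 2 → ℤ)
    (ha0 : toR2 a0 ∈ P) (ha1 : toR2 (a0 + u) ∈ P) (hb0 : toR2 b0 ∈ Q) (hb1 : toR2 (b0 + w) ∈ Q)
    (hN : u 0 * w 1 - u 1 * w 0 ≠ 0)
    (starQ : ∀ c : Fin 2 → ℤ, toR2 c ∈ Q → ∀ x y : ℝ,
      (∀ i, (c i : ℝ) = b0 i + x * u i + y * w i) → 0 < y → y < 1 → |x| < 1 → False)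
    (starP : ∀ c : Fin 2 → ℤ, toR2 c ∈ P → ∀ x y : ℝ,
      (∀ i, (c i : ℝ) = a0 i + x * u i + y * w i) → 0 < x → x < 1 → |y| < 1 → False) :
    |u 0 * w 1 - u 1 * w 0| = 1 := by
  classical
  wlog hpos : 0 < u 0 * w 1 - u 1 * w 0 generalizing a0 u
  · have h := this (a0 + u) (-u) ha1 (by simpa using ha0)
      (by simp only [Pi.neg_apply]; intro h; apply hN; linarith)
      (by
        intro c hc x y h hy hy' hx
        exact starQ c hc (-x) y (by intro i; rw [h i]; simp) hy hy' (by rwa [abs_neg]))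
      (by
        intro c hc x y h hx hx' hy
        exact starP c hc (1 - x) y (by intro i; rw [h i]; simp; ring) (by linarith) (by linarith) hy)
      (by
        have : u 0 * w 1 - u 1 * w 0 < 0 := lt_of_le_of_ne (not_lt.1 hpos) hN
        simp only [Pi.neg_apply]
        linarith)
    rw [← h, ← abs_neg]; congr 1; simp only [Pi.neg_apply]; ring
  obtain ⟨N, hNe⟩ : ∃ N, N = u 0 * w 1 - u 1 * w 0 := ⟨_, rfl⟩
  rw [← hNe] at hpos ⊢
  rw [abs_of_pos hpos]
  by_contra hne
  have hN2 : 2 ≤ N := by omega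
  have hNR : (0:ℝ) < N := by exact_mod_cast hpos
  have hull : ∀ (S : Set (Fin 2 → ℝ)) (V : Finset (Fin 2 → ℤ)) (a b : Fin 2 → ℤ),
      S = convexHull ℝ (toR2 '' ↑V) → toR2 a ∈ S → toR2 b ∈ S →
      S = convexHull ℝ (toR2 '' ↑(insert a (insert b V))) := by
    intro S V a b hS ha hb
    apply Set.Subset.antisymm
    · rw [hS]
      apply convexHull_mono
      apply Set.image_mono
      intro c hc
      simp only [Finset.coe_insert, Set.mem_insert_iff]
      right; right; exact hc
    · apply convexHull_min
      · rintro _ ⟨c, hc, rfl⟩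
        simp only [Finset.coe_insert, Set.mem_insert_iff] at hc
        rcases hc with rfl | rfl | hc
        · exact ha
        · exact hb
        · rw [hS]; exact subset_convexHull _ _ ⟨c, hc, rfl⟩
      · rw [hS]; exact convex_convexHull _ _
  have hP' := hull P VP a0 (a0 + u) hP ha0 ha1
  have hQ' := hull Q VQ b0 (b0 + w) hQ hb0 hb1
  have conv : ∀ (c o : Fin 2 → ℤ) (x y : ℤ), (∀ i, N * (c i - o i) = x * u i + y * w i) →
      ∀ i, (c i : ℝ) = o i + (x / N : ℝ) * u i + (y / N : ℝ) * w i := by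
    intro c o x y h i
    have : (N:ℝ) * (c i - o i) = x * u i + y * w i := by exact_mod_cast h i
    field_simp
    linarith
  have habs : ∀ x : ℤ, |x| < N → |(x / N : ℝ)| < 1 := by
    intro x hx
    rw [abs_div, abs_of_pos hNR, div_lt_one hNR]
    exact_mod_cast hx
  refine lem22 P Q _ _ hP' hQ' (lemFace P Q _ _ (by simp) hP' hQ' hPQ) a0 b0 u w
    (by simp) (by simp) (by simp) (by simp) N hNe hN2 ?_ ?_
  · intro c hc x y h hy hy' hx
    refine starQ c hc _ _ (conv c b0 x y h) ?_ ?_ (habs x hx)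
    · exact div_pos (by exact_mod_cast hy) hNR
    · rw [div_lt_one hNR]; exact_mod_cast hy'
  · intro c hc x y h hx hx' hy
    refine starP c hc _ _ (conv c a0 x y h) ?_ ?_ (habs y hy)
    · exact div_pos (by exact_mod_cast hx) hNR
    · rw [div_lt_one hNR]; exact_mod_cast hx'

def InCone (v : Fin 4 → Fin 4 → ℤ) (y : Fin 4 → ℝ) : Prop :=
  ∃ l : Fin 4 → ℝ, (∀ j, 0 ≤ l j) ∧ ∀ k, y k = ∑ j, l j * v j k

theorem lemStep (v : Fin 4 → Fin 4 → ℤ) (c : Fin 4 → ℤ) (l : Fin 4 → ℝ) (hl : ∀ j, 0 ≤ l j)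
    (θ : ℝ) (hθ : 0 ≤ θ) (g : Fin 4 → ℝ) (hg : ∀ k, (c k : ℝ) = ∑ j, g j * v j k)
    (hpos : ∃ j, 0 < g j) :
    ∃ i, 0 < g i ∧ InCone (Function.update v i c) (fun k => ∑ j, l j * v j k + θ * c k) := by
  obtain ⟨j0, hj0⟩ := hpos
  obtain ⟨i, hi, hmin⟩ := Finset.exists_min_image (Finset.univ.filter fun j => 0 < g j)
    (fun j => l j / g j) ⟨j0, by simp [hj0]⟩
  simp only [Finset.mem_filter, Finset.mem_univ, true_and] at hi hmin
  refine ⟨i, hi, fun j => if j = i then θ + l i / g i else l j - l i / g i * g j, ?_, ?_⟩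
  · intro j
    have hq : 0 ≤ l i / g i := div_nonneg (hl i) hi.le
    simp only
    split_ifs with h
    · positivity
    · rcases lt_or_ge 0 (g j) with hj | hj
      · have := hmin j hj
        rw [le_div_iff₀ hj] at this
        linarith
      · have := hl j
        nlinarith
  · intro k
    have e : ∀ j, (if j = i then θ + l i / g i else l j - l i / g i * g j) *
        ((Function.update v i c j k : ℤ) : ℝ) =
        (l j * v j k - l i / g i * (g j * v j k)) + if j = i then (θ + l i / g i) * c k else 0 := by
      intro j
      by_cases h : j = i
      · subst h
        simp
        field_simp
        ring
      · simp [h, Function.update_of_ne]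
        ring
    simp only
    rw [Finset.sum_congr rfl (fun j _ => e j), Finset.sum_add_distrib, Finset.sum_sub_distrib,
      ← Finset.mul_sum, ← hg k]
    simp
    ring

theorem lemDet (v : Fin 4 → Fin 4 → ℤ) (c : Fin 4 → ℤ) (g : Fin 4 → ℝ)
    (hg : ∀ k, (c k : ℝ) = ∑ j, g j * v j k) (i : Fin 4) :
    (((Matrix.of (Function.update v i c)).det : ℤ) : ℝ) = g i * ((Matrix.of v).det : ℤ) := by
  have h := Matrix.det_updateRow_sum ((Matrix.of v).map (Int.castRingHom ℝ)) i g
  rw [← RingHom.mapMatrix_apply, ← RingHom.map_det] at h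
  simp only [eq_intCast, smul_eq_mul] at h
  rw [← h, ← eq_intCast (Int.castRingHom ℝ), RingHom.map_det]
  congr 1
  ext a b
  by_cases hab : a = i
  · subst hab
    simp [hg, Matrix.updateRow_self]
  · simp [Matrix.updateRow_ne hab, Function.update_of_ne hab]

theorem lemBary (v : Fin 4 → Fin 4 → ℤ) (c : Fin 4 → ℤ) (h : (Matrix.of v).det ≠ 0) :
    ∃ g : Fin 4 → ℝ, ∀ k, (c k : ℝ) = ∑ j, g j * v j k := by
  let M : Matrix (Fin 4) (Fin 4) ℝ := (Matrix.of v).map (Int.castRingHom ℝ)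
  have hM : IsUnit M.det := by
    have : M.det = (((Matrix.of v).det : ℤ) : ℝ) := by
      rw [← eq_intCast (Int.castRingHom ℝ), RingHom.map_det]; rfl
    rw [this]
    exact isUnit_iff_ne_zero.2 (by exact_mod_cast h)
  refine ⟨Matrix.vecMul (fun k => (c k : ℝ)) M⁻¹, ?_⟩
  intro k
  have : Matrix.vecMul (Matrix.vecMul (fun k => (c k : ℝ)) M⁻¹) M = fun k => (c k : ℝ) := by
    rw [Matrix.vecMul_vecMul, Matrix.nonsing_inv_mul _ hM, Matrix.vecMul_one]
  have := congrFun this k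
  rw [← this]
  simp [Matrix.vecMul, dotProduct, M]

theorem lemMin (S : Set (Fin 4 → ℤ)) (hS : ∀ z ∈ S, z 2 + z 3 = 1) (v0 : Fin 4 → Fin 4 → ℤ)
    (hv0 : ∀ j, v0 j ∈ S) (hd0 : (Matrix.of v0).det ≠ 0) (F : Finset (Fin 4 → ℤ))
    (hF : ∀ z ∈ F, z ∈ S) (μ : (Fin 4 → ℤ) → ℝ) (hμ : ∀ z, 0 ≤ μ z) :
    ∃ v : Fin 4 → Fin 4 → ℤ, (∀ j, v j ∈ S) ∧ (Matrix.of v).det ≠ 0 ∧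
      InCone v (fun k => ∑ z ∈ F, μ z * z k) ∧
      ∀ c ∈ S, ∀ g : Fin 4 → ℝ, (∀ k, (c k : ℝ) = ∑ j, g j * v j k) → ∃ j, 1 ≤ g j := by
  classical
  have hgpos : ∀ v : Fin 4 → Fin 4 → ℤ, (∀ j, v j ∈ S) → ∀ c ∈ S, ∀ g : Fin 4 → ℝ,
      (∀ k, (c k : ℝ) = ∑ j, g j * v j k) → ∃ j, 0 < g j := by
    intro v hv c hc g hg
    by_contra hcon
    push Not at hcon
    have h1 : (c 2 : ℝ) + c 3 = 1 := by exact_mod_cast hS c hc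
    have h2 : ∀ j, (v j 2 : ℝ) + v j 3 = 1 := fun j => by exact_mod_cast hS _ (hv j)
    rw [hg, hg, ← Finset.sum_add_distrib] at h1
    have : ∑ j, (g j * (v j 2 : ℝ) + g j * v j 3) ≤ 0 := by
      apply Finset.sum_nonpos
      intro j _
      rw [← mul_add, h2, mul_one]
      exact hcon j
    linarith
  have hstep : ∀ v : Fin 4 → Fin 4 → ℤ, (∀ j, v j ∈ S) → (Matrix.of v).det ≠ 0 → ∀ c ∈ S,
      ∀ i, ∀ g : Fin 4 → ℝ, (∀ k, (c k : ℝ) = ∑ j, g j * v j k) → 0 < g i →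
      (∀ j, Function.update v i c j ∈ S) ∧ (Matrix.of (Function.update v i c)).det ≠ 0 := by
    intro v hv hd c hc i g hg hgi
    constructor
    · intro j
      by_cases h : j = i
      · subst h; simpa using hc
      · rw [Function.update_of_ne h]; exact hv j
    · intro h
      have := lemDet v c g hg i
      rw [h] at this
      have h2 : ((Matrix.of v).det : ℝ) ≠ 0 := by exact_mod_cast hd
      have := mul_ne_zero hgi.ne' h2
      simp_all
  have hex : ∃ v : Fin 4 → Fin 4 → ℤ, (∀ j, v j ∈ S) ∧ (Matrix.of v).det ≠ 0 ∧
      InCone v (fun k => ∑ z ∈ F, μ z * z k) := by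
    induction F using Finset.induction_on with
    | empty => exact ⟨v0, hv0, hd0, fun _ => 0, fun _ => le_rfl, by simp⟩
    | insert a F ha ih =>
      obtain ⟨v, hv, hd, l, hl, hy⟩ := ih (fun z hz => hF z (Finset.mem_insert_of_mem hz))
      have haS := hF a (Finset.mem_insert_self _ _)
      obtain ⟨g, hg⟩ := lemBary v a hd
      obtain ⟨i, hi, hc⟩ := lemStep v a l hl (μ a) (hμ a) g hg (hgpos v hv a haS g hg)
      obtain ⟨h1, h2⟩ := hstep v hv hd a haS i g hg hi
      refine ⟨_, h1, h2, ?_⟩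
      convert hc using 1
      funext k
      have hk := hy k
      simp only at hk
      rw [Finset.sum_insert ha, hk]
      ring
  let T : Set (Fin 4 → Fin 4 → ℤ) := {v | (∀ j, v j ∈ S) ∧ (Matrix.of v).det ≠ 0 ∧
      InCone v (fun k => ∑ z ∈ F, μ z * z k)}
  obtain ⟨v, ⟨hv, hd, l, hl, hy⟩, hmin⟩ :=
    (measure (fun v : Fin 4 → Fin 4 → ℤ => (Matrix.of v).det.natAbs)).wf.has_min T hex
  refine ⟨v, hv, hd, ⟨l, hl, hy⟩, ?_⟩
  intro c hc g hg
  by_contra hcon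
  push Not at hcon
  obtain ⟨i, hi, hcone⟩ := lemStep v c l hl 0 le_rfl g hg (hgpos v hv c hc g hg)
  obtain ⟨h1, h2⟩ := hstep v hv hd c hc i g hg hi
  refine hmin (Function.update v i c) ⟨h1, h2, ?_⟩ ?_
  · convert hcone using 1
    funext k
    have hk := hy k
    simp only at hk
    rw [hk]; ring
  · show (Matrix.of (Function.update v i c)).det.natAbs < (Matrix.of v).det.natAbs
    zify
    have := lemDet v c g hg i
    have h3 : |(((Matrix.of (Function.update v i c)).det : ℤ) : ℝ)| < |((Matrix.of v).det : ℝ)| := by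
      rw [this, abs_mul, abs_of_pos hi]
      have h2 : 0 < |((Matrix.of v).det : ℝ)| := abs_pos.2 (by exact_mod_cast hd)
      have := hcon i
      nlinarith
    exact_mod_cast h3

def SS (P Q : Set (Fin 2 → ℝ)) : Set (Fin 4 → ℤ) :=
  {z | (z 2 = 1 ∧ z 3 = 0 ∧ toR2 ![z 0, z 1] ∈ P) ∨ (z 2 = 0 ∧ z 3 = 1 ∧ toR2 ![z 0, z 1] ∈ Q)}

def Good (S : Set (Fin 4 → ℤ)) (y : Fin 4 → ℝ) (v : Fin 4 → Fin 4 → ℤ) : Prop :=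
  (∀ j, v j ∈ S) ∧ (Matrix.of v).det ≠ 0 ∧ InCone v y ∧
    ∀ c ∈ S, ∀ g : Fin 4 → ℝ, (∀ k, (c k : ℝ) = ∑ j, g j * v j k) → ∃ j, 1 ≤ g j

theorem good_perm (S) (y) (v) (σ : Equiv.Perm (Fin 4)) (h : Good S y v) :
    Good S y (v ∘ σ) := by
  obtain ⟨h1, h2, ⟨l, hl, hy⟩, h4⟩ := h
  refine ⟨fun j => h1 _, ?_, ⟨l ∘ σ, fun j => hl _, fun k => ?_⟩, ?_⟩
  · have := Matrix.det_permute σ (Matrix.of v)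
    have e : (Matrix.of (v ∘ σ)) = (Matrix.of v).submatrix σ id := rfl
    rw [e, this]
    refine mul_ne_zero ?_ h2
    rcases Int.units_eq_one_or (Equiv.Perm.sign σ) with h | h <;> rw [h] <;> decide
  · rw [hy k]
    exact (Equiv.sum_comp σ (fun j => l j * (v j k : ℝ))).symm
  · intro c hc g hg
    obtain ⟨j, hj⟩ := h4 c hc (g ∘ σ.symm) (fun k => by
      rw [hg k, ← Equiv.sum_comp σ (fun j => (g ∘ σ.symm) j * (v j k : ℝ))]
      simp)
    exact ⟨_, hj⟩

theorem det4 (v : Fin 4 → Fin 4 → ℤ) (h : ∀ j, v j 2 = 1 - v j 3) :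
    (Matrix.of ![(![v 1 0, v 1 1, v 1 3] : Fin 3 → ℤ) - ![v 0 0, v 0 1, v 0 3],
      ![v 2 0, v 2 1, v 2 3] - ![v 0 0, v 0 1, v 0 3],
      ![v 3 0, v 3 1, v 3 3] - ![v 0 0, v 0 1, v 0 3]]).det = - (Matrix.of v).det ∨
    (Matrix.of ![(![v 1 0, v 1 1, v 1 3] : Fin 3 → ℤ) - ![v 0 0, v 0 1, v 0 3],
      ![v 2 0, v 2 1, v 2 3] - ![v 0 0, v 0 1, v 0 3],
      ![v 3 0, v 3 1, v 3 3] - ![v 0 0, v 0 1, v 0 3]]).det = (Matrix.of v).det := by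
  rw [Matrix.det_fin_three, Matrix.det_succ_row_zero]
  simp [Fin.sum_univ_four, Matrix.det_fin_three, Fin.succAbove, h]
  right; ring

theorem det4_formula (v : Fin 4 → Fin 4 → ℤ) (h : ∀ j, v j 2 = 1 - v j 3) :
    |(Matrix.of v).det| = |(Matrix.of ![(![v 1 0, v 1 1, v 1 3] : Fin 3 → ℤ) - ![v 0 0, v 0 1, v 0 3],
      ![v 2 0, v 2 1, v 2 3] - ![v 0 0, v 0 1, v 0 3],
      ![v 3 0, v 3 1, v 3 3] - ![v 0 0, v 0 1, v 0 3]]).det| := by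
  rcases det4 v h with h | h <;> rw [h]
  rw [abs_neg]

theorem good_det (P Q : Set (Fin 2 → ℝ)) (VP VQ : Finset (Fin 2 → ℤ)) (hVQ : VQ.Nonempty)
    (hP : P = convexHull ℝ (toR2 '' ↑VP)) (hQ : Q = convexHull ℝ (toR2 '' ↑VQ))
    (hPQ : IsWeakMinkowskiSummand P Q) (y) (v) (h : Good (SS P Q) y v)
    (hm : Monotone (fun j => v j 3)) : |(Matrix.of v).det| = 1 := by
  obtain ⟨h1, h2, -, h4⟩ := h
  have hPc : Convex ℝ P := by rw [hP]; exact convex_convexHull _ _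
  have hQc : Convex ℝ Q := by rw [hQ]; exact convex_convexHull _ _
  have h23 : ∀ j, v j 2 = 1 - v j 3 := by
    intro j
    rcases h1 j with ⟨a, b, -⟩ | ⟨a, b, -⟩ <;> rw [a, b] <;> rfl
  have hdP : ∀ j, v j 3 = 0 → toR2 ![v j 0, v j 1] ∈ P := by
    intro j hj
    rcases h1 j with ⟨a, b, c⟩ | ⟨a, b, c⟩
    · exact c
    · omega
  have hdQ : ∀ j, v j 3 = 1 → toR2 ![v j 0, v j 1] ∈ Q := by
    intro j hj
    rcases h1 j with ⟨a, b, c⟩ | ⟨a, b, c⟩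
    · omega
    · exact c
  have hcP : ∀ c : Fin 2 → ℤ, toR2 c ∈ P → (![c 0, c 1, 1, 0] : Fin 4 → ℤ) ∈ SS P Q := by
    intro c hc
    left
    refine ⟨rfl, rfl, ?_⟩
    convert hc using 2
    funext i; fin_cases i <;> rfl
  have hcQ : ∀ c : Fin 2 → ℤ, toR2 c ∈ Q → (![c 0, c 1, 0, 1] : Fin 4 → ℤ) ∈ SS P Q := by
    intro c hc
    right
    refine ⟨rfl, rfl, ?_⟩
    convert hc using 2
    funext i; fin_cases i <;> rfl
  have h01 : ∀ j, v j 3 = 0 ∨ v j 3 = 1 := by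
    intro j
    rcases h1 j with ⟨a, b, -⟩ | ⟨a, b, -⟩ <;> omega
  have m01 : v 0 3 ≤ v 1 3 := hm (by decide)
  have m12 : v 1 3 ≤ v 2 3 := hm (by decide)
  have m23 : v 2 3 ≤ v 3 3 := hm (by decide)
  have hadd : ∀ i j : Fin 4, (![v i 0, v i 1] : Fin 2 → ℤ) + ![v j 0 - v i 0, v j 1 - v i 1]
      = ![v j 0, v j 1] := by
    intro i j
    funext k; fin_cases k <;> simp
  have e2 := fun j => h23 j
  rw [det4_formula v h23]
  have h2' := h2
  rw [← abs_pos, det4_formula v h23, Matrix.det_fin_three] at h2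
  rw [Matrix.det_fin_three]
  simp at h2 ⊢
  rcases h01 0 with k0 | k0 <;> rcases h01 1 with k1 | k1 <;> rcases h01 2 with k2 | k2 <;>
    rcases h01 3 with k3 | k3 <;> first | omega | skip
  all_goals simp [k0, k1, k2, k3] at h2 ⊢
  · have := lem3 P hPc ![v 0 0, v 0 1] ![v 1 0 - v 0 0, v 1 1 - v 0 1] ![v 2 0 - v 0 0, v 2 1 - v 0 1]
      (hdP 0 k0) (by rw [hadd]; exact hdP 1 k1) (by rw [hadd]; exact hdP 2 k2)
      (by simpa using h2)
      (by
        intro c hc x y hxy hx hy hs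
        have q0 := hxy 0
        have q1 := hxy 1
        simp at q0 q1
        obtain ⟨j, hj⟩ := h4 _ (hcP c hc) ![1 - x - y, x, y, 0] (by
          intro k
          fin_cases k <;> simp [Fin.sum_univ_four, h23, k0, k1, k2, k3] <;> linarith)
        fin_cases j <;> simp at hj <;> linarith)
    simpa using this
  · have := lem22' P Q VP VQ hVQ hP hQ hPQ ![v 0 0, v 0 1] ![v 2 0, v 2 1]
      ![v 1 0 - v 0 0, v 1 1 - v 0 1] ![v 3 0 - v 2 0, v 3 1 - v 2 1]
      (hdP 0 k0) (by rw [hadd]; exact hdP 1 k1) (hdQ 2 k2) (by rw [hadd]; exact hdQ 3 k3)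
      (by
        simp
        intro h
        apply h2
        linear_combination -h)
      (by
        intro c hc x y hxy hx hy hs
        rw [abs_lt] at hs
        have q0 := hxy 0
        have q1 := hxy 1
        simp at q0 q1
        obtain ⟨j, hj⟩ := h4 _ (hcQ c hc) ![-x, x, 1 - y, y] (by
          intro k
          fin_cases k <;> simp [Fin.sum_univ_four, h23, k0, k1, k2, k3] <;> linarith)
        fin_cases j <;> simp at hj <;> linarith)
      (by
        intro c hc x y hxy hx hy hs
        rw [abs_lt] at hs
        have q0 := hxy 0
        have q1 := hxy 1
        simp at q0 q1
        obtain ⟨j, hj⟩ := h4 _ (hcP c hc) ![1 - x, x, -y, y] (by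
          intro k
          fin_cases k <;> simp [Fin.sum_univ_four, h23, k0, k1, k2, k3] <;> linarith)
        fin_cases j <;> simp at hj <;> linarith)
    rw [← this, ← abs_neg]
    congr 1
    simp
    ring
  · have := lem3 Q hQc ![v 1 0, v 1 1] ![v 2 0 - v 1 0, v 2 1 - v 1 1] ![v 3 0 - v 1 0, v 3 1 - v 1 1]
      (hdQ 1 k1) (by rw [hadd]; exact hdQ 2 k2) (by rw [hadd]; exact hdQ 3 k3)
      (by
        simp
        intro h
        apply h2
        linear_combination h)
      (by
        intro c hc x y hxy hx hy hs
        have q0 := hxy 0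
        have q1 := hxy 1
        simp at q0 q1
        obtain ⟨j, hj⟩ := h4 _ (hcQ c hc) ![0, 1 - x - y, x, y] (by
          intro k
          fin_cases k <;> simp [Fin.sum_univ_four, h23, k0, k1, k2, k3] <;> linarith)
        fin_cases j <;> simp at hj <;> linarith)
    rw [← this]
    congr 1
    simp
    ring

theorem lemInit (Q : Set (Fin 2 → ℝ)) (VQ : Finset (Fin 2 → ℤ)) (hVQ : VQ.Nonempty)
    (hQ : Q = convexHull ℝ (toR2 '' ↑VQ)) (hdim : affineSpan ℝ Q = ⊤) :
    ∃ p ∈ VQ, ∃ q ∈ VQ, ∃ r ∈ VQ,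
      (q 0 - p 0) * (r 1 - p 1) - (q 1 - p 1) * (r 0 - p 0) ≠ 0 := by
  by_contra hcon
  push Not at hcon
  obtain ⟨p, hp⟩ := hVQ
  obtain ⟨α, β, hne, hab⟩ : ∃ α β : ℤ, (0 < α ^ 2 + β ^ 2) ∧
      ∀ r ∈ VQ, α * (r 0 - p 0) + β * (r 1 - p 1) = 0 := by
    by_cases h : ∃ q ∈ VQ, q ≠ p
    · obtain ⟨q, hq, hqp⟩ := h
      refine ⟨-(q 1 - p 1), q 0 - p 0, ?_, ?_⟩
      · by_contra h
        apply hqp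
        have h0 : q 0 - p 0 = 0 := by nlinarith [sq_nonneg (q 0 - p 0), sq_nonneg (q 1 - p 1)]
        have h1 : q 1 - p 1 = 0 := by nlinarith [sq_nonneg (q 0 - p 0), sq_nonneg (q 1 - p 1)]
        funext i
        fin_cases i
        · show q 0 = p 0
          omega
        · show q 1 = p 1
          omega
      · intro r hr
        linear_combination hcon p hp q hq r hr
    · push Not at h
      refine ⟨1, 0, by norm_num, ?_⟩
      intro r hr
      rw [h r hr]; ring
  let f : (Fin 2 → ℝ) →ₗ[ℝ] ℝ := (α:ℝ) • LinearMap.proj 0 + (β:ℝ) • LinearMap.proj 1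
  have hle : affineSpan ℝ Q ≤ AffineSubspace.mk' (toR2 p) (LinearMap.ker f) := by
    rw [hQ, affineSpan_convexHull, affineSpan_le]
    rintro _ ⟨r, hr, rfl⟩
    show toR2 r ∈ AffineSubspace.mk' (toR2 p) (LinearMap.ker f)
    rw [AffineSubspace.mem_mk', LinearMap.mem_ker]
    have := hab r hr
    simp [f, toR2]
    exact_mod_cast this
  have : toR2 p + ![(α:ℝ), (β:ℝ)] ∈ AffineSubspace.mk' (toR2 p) (LinearMap.ker f) := by
    apply hle
    rw [hdim]
    trivial
  rw [AffineSubspace.mem_mk', LinearMap.mem_ker] at this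
  simp [f] at this
  have h3 : α * α + β * β = 0 := by exact_mod_cast this
  nlinarith

def eP (c : Fin 2 → ℤ) : Fin 4 → ℤ := ![c 0, c 1, 1, 0]
def eQ (c : Fin 2 → ℤ) : Fin 4 → ℤ := ![c 0, c 1, 0, 1]
def FF (VP VQ : Finset (Fin 2 → ℤ)) : Finset (Fin 4 → ℤ) := VP.image eP ∪ VQ.image eQ
def KK (F : Finset (Fin 4 → ℤ)) : Set (Fin 4 → ℝ) :=
  {y | ∃ μ : (Fin 4 → ℤ) → ℝ, (∀ z, 0 ≤ μ z) ∧ ∀ k, y k = ∑ z ∈ F, μ z * z k}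

theorem KK_convex (F) : Convex ℝ (KK F) := by
  rintro x ⟨μ, hμ, hx⟩ y ⟨ν, hν, hy⟩ a b ha hb hab
  refine ⟨fun z => a * μ z + b * ν z, fun z => add_nonneg (mul_nonneg ha (hμ z)) (mul_nonneg hb (hν z)), ?_⟩
  intro k
  simp only [Pi.add_apply, Pi.smul_apply, smul_eq_mul, hx k, hy k, Finset.mul_sum,
    ← Finset.sum_add_distrib]
  apply Finset.sum_congr rfl
  intros; ring

theorem KK_mem (F : Finset (Fin 4 → ℤ)) (z) (hz : z ∈ F) : (fun k => (z k : ℝ)) ∈ KK F := by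
  classical
  refine ⟨fun w => if w = z then 1 else 0, fun w => by dsimp only; split <;> norm_num, ?_⟩
  intro k
  simp [hz]

theorem hull_aff (V : Finset (Fin 2 → ℤ)) (K : Set (Fin 4 → ℝ)) (hK : Convex ℝ K) (s t : ℝ)
    (h : ∀ c ∈ V, (![(c 0 : ℝ), c 1, s, t] : Fin 4 → ℝ) ∈ K) :
    ∀ x ∈ convexHull ℝ (toR2 '' (V : Set (Fin 2 → ℤ))), (![x 0, x 1, s, t] : Fin 4 → ℝ) ∈ K := by
  intro x hx
  refine convexHull_min (t := {x : Fin 2 → ℝ | (![x 0, x 1, s, t] : Fin 4 → ℝ) ∈ K}) ?_ ?_ hx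
  · rintro _ ⟨c, hc, rfl⟩
    exact h c hc
  · intro x hx y hy a b ha hb hab
    have := hK hx hy ha hb hab
    show (![_, _, s, t] : Fin 4 → ℝ) ∈ K
    convert this using 1
    funext k
    fin_cases k <;> simp [← add_mul, hab]

theorem cay_KK (P Q : Set (Fin 2 → ℝ)) (VP VQ : Finset (Fin 2 → ℤ))
    (hP : P = convexHull ℝ (toR2 '' ↑VP)) (hQ : Q = convexHull ℝ (toR2 '' ↑VQ)) (x) (hx : x ∈ cay P Q) :
    (![x 0, x 1, 1 - x 2, x 2] : Fin 4 → ℝ) ∈ KK (FF VP VQ) := by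
  have hcv := KK_convex (FF VP VQ)
  refine convexHull_min (t := {x : Fin 3 → ℝ | (![x 0, x 1, 1 - x 2, x 2] : Fin 4 → ℝ) ∈ KK (FF VP VQ)}) ?_ ?_ hx
  · rintro _ (⟨p, hp, rfl⟩ | ⟨p, hp, rfl⟩)
    · rw [hP] at hp
      have := hull_aff VP _ hcv 1 0 (by
        intro c hc
        convert KK_mem (FF VP VQ) (eP c) (Finset.mem_union_left _ (Finset.mem_image_of_mem _ hc)) using 1
        funext k; fin_cases k <;> simp [eP]) p hp
      show (![_, _, _, _] : Fin 4 → ℝ) ∈ KK (FF VP VQ)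
      convert this using 1
      funext k; fin_cases k <;> simp [Fin.snoc]
    · rw [hQ] at hp
      have := hull_aff VQ _ hcv 0 1 (by
        intro c hc
        convert KK_mem (FF VP VQ) (eQ c) (Finset.mem_union_right _ (Finset.mem_image_of_mem _ hc)) using 1
        funext k; fin_cases k <;> simp [eQ]) p hp
      show (![_, _, _, _] : Fin 4 → ℝ) ∈ KK (FF VP VQ)
      convert this using 1
      funext k; fin_cases k <;> simp [Fin.snoc]
  · intro x hx y hy a b ha hb hab
    have := hcv hx hy ha hb hab
    show (![_, _, _, _] : Fin 4 → ℝ) ∈ KK (FF VP VQ)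
    convert this using 1
    funext k
    fin_cases k <;> simp
    linear_combination -hab

theorem SS_cay (P Q : Set (Fin 2 → ℝ)) (z) (hz : z ∈ SS P Q) :
    toR3 ![z 0, z 1, z 3] ∈ cay P Q := by
  apply subset_convexHull
  rcases hz with ⟨h2, h3, h⟩ | ⟨h2, h3, h⟩
  · left
    refine ⟨_, h, ?_⟩
    funext k; fin_cases k <;> simp [Fin.snoc, toR2, toR3, h3]
  · right
    refine ⟨_, h, ?_⟩
    funext k; fin_cases k <;> simp [Fin.snoc, toR2, toR3, h3]

theorem main_pt (P Q : Set (Fin 2 → ℝ)) (VP VQ : Finset (Fin 2 → ℤ)) (hVP : VP.Nonempty) (hVQ : VQ.Nonempty)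
    (hP : P = convexHull ℝ (toR2 '' ↑VP)) (hQ : Q = convexHull ℝ (toR2 '' ↑VQ))
    (hdim : affineSpan ℝ Q = ⊤)
    (hPQ : IsWeakMinkowskiSummand P Q) (x) (hx : x ∈ cay P Q) :
    ∃ S, (IsUnimodularTet S ∧ S ⊆ cay P Q) ∧ x ∈ S := by
  obtain ⟨μ, hμ, hμx⟩ := cay_KK P Q VP VQ hP hQ x hx
  have hS : ∀ z ∈ SS P Q, z 2 + z 3 = 1 := by
    rintro z (⟨a, b, -⟩ | ⟨a, b, -⟩) <;> rw [a, b] <;> rfl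
  have heP : ∀ c ∈ VP, eP c ∈ SS P Q := by
    intro c hc
    left
    refine ⟨rfl, rfl, ?_⟩
    rw [hP]
    apply subset_convexHull
    refine ⟨c, hc, ?_⟩
    congr 1
    funext i; fin_cases i <;> rfl
  have heQ : ∀ c ∈ VQ, eQ c ∈ SS P Q := by
    intro c hc
    right
    refine ⟨rfl, rfl, ?_⟩
    rw [hQ]
    apply subset_convexHull
    refine ⟨c, hc, ?_⟩
    congr 1
    funext i; fin_cases i <;> rfl
  obtain ⟨p, hp, q, hq, r, hr, hpqr⟩ := lemInit Q VQ hVQ hQ hdim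
  obtain ⟨o, ho⟩ := hVP
  obtain ⟨v, hg⟩ : ∃ v, Good (SS P Q) (fun k => ∑ z ∈ FF VP VQ, μ z * z k) v := by
    refine lemMin (SS P Q) hS ![eP o, eQ p, eQ q, eQ r] ?_ ?_ (FF VP VQ) ?_ μ hμ
    · intro j; fin_cases j
      · exact heP o ho
      · exact heQ p hp
      · exact heQ q hq
      · exact heQ r hr
    · rw [← abs_pos, det4_formula _ (by intro j; fin_cases j <;> simp [eP, eQ]), abs_pos, Matrix.det_fin_three]
      simp [eP, eQ]
      intro h
      apply hpqr
      linear_combination h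
    · intro z hz
      rcases Finset.mem_union.1 hz with hz | hz
      · obtain ⟨c, hc, rfl⟩ := Finset.mem_image.1 hz
        exact heP c hc
      · obtain ⟨c, hc, rfl⟩ := Finset.mem_image.1 hz
        exact heQ c hc
  have hg2 := good_perm _ _ _ (Tuple.sort (fun j => v j 3)) hg
  generalize hv' : v ∘ (Tuple.sort (fun j => v j 3)) = v' at hg2
  have hm : Monotone (fun j => v' j 3) := by
    rw [← hv']
    exact Tuple.monotone_sort (fun j => v j 3)
  have hdet := good_det P Q VP VQ hVQ hP hQ hPQ _ v' hg2 hm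
  obtain ⟨h1, -, ⟨l, hl, hy⟩, -⟩ := hg2
  have h23 : ∀ j, v' j 2 = 1 - v' j 3 := fun j => by linarith [hS _ (h1 j)]
  rw [det4_formula v' h23] at hdet
  refine ⟨_, ⟨⟨fun j => ![v' j 0, v' j 1, v' j 3], rfl, ?_⟩, ?_⟩, ?_⟩
  · rcases (abs_eq (by norm_num)).1 hdet with h | h
    · left; exact h
    · right; exact h
  · apply convexHull_min _ (convex_convexHull _ _)
    rintro _ (rfl | rfl | rfl | rfl) <;> exact SS_cay P Q _ (h1 _)
  · have hy' : ∀ k, (![x 0, x 1, 1 - x 2, x 2] : Fin 4 → ℝ) k = ∑ j, l j * v' j k := by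
      intro k; rw [hμx k]; exact hy k
    have y0 := hy' 0
    have y1 := hy' 1
    have y2 := hy' 2
    have y3 := hy' 3
    simp [Fin.sum_univ_four, h23] at y0 y1 y2 y3
    have hm := (convex_convexHull ℝ ({toR3 ![v' 0 0, v' 0 1, v' 0 3], toR3 ![v' 1 0, v' 1 1, v' 1 3], toR3 ![v' 2 0, v' 2 1, v' 2 3], toR3 ![v' 3 0, v' 3 1, v' 3 3]} : Set (Fin 3 → ℝ))).sum_mem
      (t := (Finset.univ : Finset (Fin 4))) (w := l)
      (z := fun j => toR3 ![v' j 0, v' j 1, v' j 3]) (fun j _ => hl j)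
      (by simp [Fin.sum_univ_four]; linarith)
      (by
        intro j _
        apply subset_convexHull
        fin_cases j <;> simp)
    convert hm using 1
    funext k
    fin_cases k <;> simp [Fin.sum_univ_four, toR3] <;> linarith

theorem cayley_sum_has_unimodular_cover
    (P Q : Set (Fin 2 → ℝ))
    (hQ : IsLatticePolytope2 Q) (hQdim : affineSpan ℝ Q = ⊤)
    (hP : IsLatticePolytope2 P)
    (hPQ : IsWeakMinkowskiSummand P Q) :
    HasUnimodularCover (cay P Q) := by
  obtain ⟨VQ, hVQ, hQ⟩ := hQ
  obtain ⟨VP, hVP, hP⟩ := hP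
  refine ⟨{S | IsUnimodularTet S ∧ S ⊆ cay P Q}, fun S hS => hS, ?_⟩
  apply Set.Subset.antisymm
  · exact Set.sUnion_subset (fun S hS => hS.2)
  · intro x hx
    obtain ⟨S, hS, hxS⟩ := main_pt P Q VP VQ hVP hVQ hP hQ hQdim hPQ x hx
    exact ⟨S, hS, hxS⟩
end
end

section
/- Let Q ⊂ ℝ^2 be a lattice polygon and let P ⊂ ℝ^2 be a lattice polytope that is a weak Minkowski summand of Q. Then the pair (P,Q) is IDP: (P+Q) ∩ ℤ^2 = (P ∩ ℤ^2) + (Q ∩ ℤ^2). -/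
open scoped Pointwise

noncomputable section

/-- The set of lattice points of `ℝ²`. -/
def Lat2 : Set (Fin 2 → ℝ) := Set.range toR2

/-- Integer pairing. -/
def LL (u z : ℤ × ℤ) : ℤ := u.1 * z.1 + u.2 * z.2

theorem push_constraints {ι : Type*} [DecidableEq ι] (J : Finset ι) (u : ι → ℤ × ℤ) (h : ι → ℤ)
    (hinf : ¬ ∃ z, ∀ i ∈ J, LL (u i) z < h i) :
    ∃ J' : Finset ι, J' ⊆ J ∧ ∃ h' : ι → ℤ, (∀ i, h i ≤ h' i) ∧ (¬ ∃ z, ∀ i ∈ J', LL (u i) z < h' i) ∧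
      ∀ i ∈ J', ∃ y, LL (u i) y = h' i ∧ ∀ j ∈ J', j ≠ i → LL (u j) y < h' j := by
  classical
  let T := J.powerset.filter (fun K => ∃ h' : ι → ℤ, (∀ i, h i ≤ h' i) ∧ ¬ ∃ z, ∀ i ∈ K, LL (u i) z < h' i)
  have hT : T.Nonempty := ⟨J, by simp only [T, Finset.mem_filter, Finset.mem_powerset]; exact ⟨subset_rfl, h, fun _ => le_rfl, hinf⟩⟩
  obtain ⟨K, hK, hmin⟩ := Finset.exists_min_image T Finset.card hT
  simp only [T, Finset.mem_filter, Finset.mem_powerset] at hK hmin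
  obtain ⟨hKJ, h0, hh0, hinf0⟩ := hK
  have key : ∀ S : Finset ι, S ⊆ K → ∃ h' : ι → ℤ, (∀ i, h i ≤ h' i) ∧ (¬ ∃ z, ∀ i ∈ K, LL (u i) z < h' i) ∧
      ∀ i ∈ S, ∃ y, LL (u i) y = h' i ∧ ∀ j ∈ K, j ≠ i → LL (u j) y < h' j := by
    intro S
    induction S using Finset.induction_on with
    | empty => intro _; exact ⟨h0, hh0, hinf0, by simp⟩
    | insert a S ha ih =>
      intro hS
      obtain ⟨h', hh', hinf', hy⟩ := ih (fun i hi => hS (Finset.mem_insert_of_mem hi))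
      have haK : a ∈ K := hS (Finset.mem_insert_self _ _)
      -- dropping a is feasible
      have hfeas : ∃ z, ∀ i ∈ K.erase a, LL (u i) z < h' i := by
        by_contra hcon
        have := hmin (K.erase a) ⟨(Finset.erase_subset _ _).trans hKJ, h', hh', hcon⟩
        have := Finset.card_erase_lt_of_mem haK
        omega
      have hge : ∀ z, (∀ i ∈ K.erase a, LL (u i) z < h' i) → h' a ≤ LL (u a) z := by
        intro z hz
        by_contra hcon
        apply hinf'
        refine ⟨z, fun i hi => ?_⟩
        by_cases hia : i = a
        · subst hia; omega
        · exact hz i (Finset.mem_erase.2 ⟨hia, hi⟩)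
      obtain ⟨m, ⟨y, hyK, hym⟩, hmmin⟩ := Int.exists_least_of_bdd
        (P := fun m => ∃ z, (∀ i ∈ K.erase a, LL (u i) z < h' i) ∧ LL (u a) z = m)
        ⟨h' a, by rintro m ⟨z, hz, rfl⟩; exact hge z hz⟩
        (by obtain ⟨z, hz⟩ := hfeas; exact ⟨_, z, hz, rfl⟩)
      have ham : h' a ≤ m := by rw [← hym]; exact hge y hyK
      have hup : ∀ i, h' i ≤ Function.update h' a m i := by
        intro i
        by_cases hia : i = a
        · subst hia; simpa using ham
        · simp [hia]
      refine ⟨Function.update h' a m, fun i => (hh' i).trans (hup i), ?_, ?_⟩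
      · rintro ⟨z, hz⟩
        have h1 : LL (u a) z < m := by simpa using hz a haK
        have h2 := hmmin (LL (u a) z) ⟨z, fun i hi => by
          have := hz i (Finset.mem_of_mem_erase hi)
          simpa [Finset.ne_of_mem_erase hi] using this, rfl⟩
        omega
      · intro i hi
        rcases Finset.mem_insert.1 hi with rfl | hi
        · refine ⟨y, by simpa using hym, fun j hj hji => ?_⟩
          simpa [hji] using hyK j (Finset.mem_erase.2 ⟨hji, hj⟩)
        · obtain ⟨y', hy1, hy2⟩ := hy i hi
          have hia : i ≠ a := fun e => ha (e ▸ hi)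
          refine ⟨y', by simpa [hia] using hy1, fun j hj hji => (hy2 j hj hji).trans_le (hup j)⟩
  obtain ⟨h', a1, a2, a3⟩ := key K subset_rfl
  exact ⟨K, hKJ, h', a1, a2, a3⟩

theorem tri_pt (a b c : ℤ × ℤ) (n : ℤ) (hn : 2 ≤ n)
    (hdet : (b.1 - a.1) * (c.2 - a.2) - (b.2 - a.2) * (c.1 - a.1) = n) :
    ∃ (A B C : ℤ) (z : ℤ × ℤ), 0 ≤ A ∧ 0 ≤ B ∧ 0 ≤ C ∧ A < n ∧ B < n ∧ C < n ∧ A + B + C = n ∧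
      n * z.1 = C * a.1 + A * b.1 + B * c.1 ∧ n * z.2 = C * a.2 + A * b.2 + B * c.2 := by
  obtain ⟨a1, a2⟩ := a
  obtain ⟨b1, b2⟩ := b
  obtain ⟨c1, c2⟩ := c
  obtain ⟨p1, rfl⟩ : ∃ p1, b1 = a1 + p1 := ⟨b1 - a1, by ring⟩
  obtain ⟨p2, rfl⟩ : ∃ p1, b2 = a2 + p1 := ⟨b2 - a2, by ring⟩
  obtain ⟨q1, rfl⟩ : ∃ p1, c1 = a1 + p1 := ⟨c1 - a1, by ring⟩
  obtain ⟨q2, rfl⟩ : ∃ p1, c2 = a2 + p1 := ⟨c2 - a2, by ring⟩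
  simp only [add_sub_cancel_left] at hdet ⊢
  -- it suffices to find e
  have main : ∀ e1 e2 : ℤ, ¬ (n ∣ e1 * q2 - e2 * q1 ∧ n ∣ p1 * e2 - p2 * e1) →
      ∃ (A B C : ℤ) (z : ℤ × ℤ), 0 ≤ A ∧ 0 ≤ B ∧ 0 ≤ C ∧ A < n ∧ B < n ∧ C < n ∧ A + B + C = n ∧
      n * z.1 = C * a1 + A * (a1 + p1) + B * (a1 + q1) ∧
      n * z.2 = C * a2 + A * (a2 + p2) + B * (a2 + q2) := by
    intro e1 e2 hnd
    set A0 := e1 * q2 - e2 * q1 with hA0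
    set B0 := p1 * e2 - p2 * e1 with hB0
    have hA := Int.emod_add_mul_ediv A0 n
    have hB := Int.emod_add_mul_ediv B0 n
    have hA1 := Int.emod_nonneg A0 (show n ≠ 0 by omega)
    have hB1 := Int.emod_nonneg B0 (show n ≠ 0 by omega)
    have hA2 := Int.emod_lt_of_pos A0 (show 0 < n by omega)
    have hB2 := Int.emod_lt_of_pos B0 (show 0 < n by omega)
    have hne : 0 < A0 % n + B0 % n := by
      by_contra hcon
      exact hnd ⟨Int.dvd_of_emod_eq_zero (by omega), Int.dvd_of_emod_eq_zero (by omega)⟩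
    set A := A0 % n
    set B := B0 % n
    set s := A0 / n
    set t := B0 / n
    have E1 : n * (e1 - s * p1 - t * q1) = A * p1 + B * q1 := by
      have hA' : A = A0 - n * s := by linarith
      have hB' : B = B0 - n * t := by linarith
      rw [hA', hB', hA0, hB0, ← hdet]; ring
    have E2 : n * (e2 - s * p2 - t * q2) = A * p2 + B * q2 := by
      have hA' : A = A0 - n * s := by linarith
      have hB' : B = B0 - n * t := by linarith
      rw [hA', hB', hA0, hB0, ← hdet]; ring
    by_cases hAB : A + B ≤ n
    · refine ⟨A, B, n - A - B, (a1 + (e1 - s * p1 - t * q1), a2 + (e2 - s * p2 - t * q2)), hA1, hB1, by omega, hA2, hB2, by omega, by ring, ?_, ?_⟩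
      · simp only; linear_combination E1
      · simp only; linear_combination E2
    · refine ⟨n - A, n - B, A + B - n, (a1 + p1 + q1 - (e1 - s * p1 - t * q1), a2 + p2 + q2 - (e2 - s * p2 - t * q2)), by omega, by omega, by omega, by omega, by omega, by omega, by ring, ?_, ?_⟩
      · simp only; linear_combination -E1
      · simp only; linear_combination -E2
  by_cases h1 : n ∣ 1 * q2 - 0 * q1 ∧ n ∣ p1 * 0 - p2 * 1
  · by_cases h2 : n ∣ 0 * q2 - 1 * q1 ∧ n ∣ p1 * 1 - p2 * 0
    · exfalso
      obtain ⟨⟨x, hx⟩, ⟨y, hy⟩⟩ := h1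
      obtain ⟨⟨z, hz⟩, ⟨w, hw⟩⟩ := h2
      have : n * (n * (w * x - y * z)) = n * 1 := by
        have e1 : q2 = n * x := by linarith
        have e2 : p2 = -(n * y) := by linarith
        have e3 : q1 = -(n * z) := by linarith
        have e4 : p1 = n * w := by linarith
        rw [e1, e2, e3, e4] at hdet
        linear_combination hdet
      have h3 := mul_left_cancel₀ (show n ≠ 0 by omega) this
      have := Int.le_of_dvd one_pos ⟨_, h3.symm⟩
      omega
    · exact main 0 1 h2
  · exact main 1 0 h1

theorem tri_feas (u a b c z : ℤ × ℤ) (h A B C n : ℤ) (hn : 2 ≤ n)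
    (hA : 0 ≤ A) (hB : 0 ≤ B) (hC : 0 ≤ C) (hA' : A < n) (hB' : B < n) (hC' : C < n) (hs : A + B + C = n)
    (hz1 : n * z.1 = C * a.1 + A * b.1 + B * c.1) (hz2 : n * z.2 = C * a.2 + A * b.2 + B * c.2)
    (ha : LL u a ≤ h) (hb : LL u b ≤ h) (hc : LL u c ≤ h)
    (hab : LL u a + LL u b < 2 * h) (hac : LL u a + LL u c < 2 * h) (hbc : LL u b + LL u c < 2 * h) :
    LL u z < h := by
  have e : n * (h - LL u z) = C * (h - LL u a) + A * (h - LL u b) + B * (h - LL u c) := by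
    simp only [LL]; rw [← hs]; rw [← hs] at hz1 hz2; linear_combination -u.1 * hz1 - u.2 * hz2
  have p1 : 0 ≤ C * (h - LL u a) := mul_nonneg hC (by omega)
  have p2 : 0 ≤ A * (h - LL u b) := mul_nonneg hA (by omega)
  have p3 : 0 ≤ B * (h - LL u c) := mul_nonneg hB (by omega)
  have : 0 < n * (h - LL u z) := by
    rw [e]
    have q1 : 0 < C → LL u a < h → 0 < C * (h - LL u a) := fun x y => mul_pos x (by omega)
    have q2 : 0 < A → LL u b < h → 0 < A * (h - LL u b) := fun x y => mul_pos x (by omega)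
    have q3 : 0 < B → LL u c < h → 0 < B * (h - LL u c) := fun x y => mul_pos x (by omega)
    by_cases r1 : 0 < C ∧ LL u a < h
    · have := q1 r1.1 r1.2; omega
    by_cases r2 : 0 < A ∧ LL u b < h
    · have := q2 r2.1 r2.2; omega
    by_cases r3 : 0 < B ∧ LL u c < h
    · have := q3 r3.1 r3.2; omega
    omega
  have := (mul_pos_iff_of_pos_left (show (0:ℤ) < n by omega)).1 this
  omega

/-- Same parity. -/
def SP (a b : ℤ × ℤ) : Prop := (2 : ℤ) ∣ a.1 - b.1 ∧ (2 : ℤ) ∣ a.2 - b.2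

theorem unimod {ι : Type*} (J : Finset ι) (u : ι → ℤ × ℤ) (h : ι → ℤ)
    (hinf : ¬ ∃ z, ∀ i ∈ J, LL (u i) z < h i) (a b c : ℤ × ℤ)
    (ha : ∀ i ∈ J, LL (u i) a ≤ h i) (hb : ∀ i ∈ J, LL (u i) b ≤ h i) (hc : ∀ i ∈ J, LL (u i) c ≤ h i)
    (hab : ∀ i ∈ J, LL (u i) a + LL (u i) b < 2 * h i)
    (hac : ∀ i ∈ J, LL (u i) a + LL (u i) c < 2 * h i)
    (hbc : ∀ i ∈ J, LL (u i) b + LL (u i) c < 2 * h i)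
    (pab : ¬ SP a b) (pac : ¬ SP a c) (pbc : ¬ SP b c) :
    (b.1 - a.1) * (c.2 - a.2) - (b.2 - a.2) * (c.1 - a.1) = 1 ∨
    (b.1 - a.1) * (c.2 - a.2) - (b.2 - a.2) * (c.1 - a.1) = -1 := by
  have hodd : ¬ (2 : ℤ) ∣ (b.1 - a.1) * (c.2 - a.2) - (b.2 - a.2) * (c.1 - a.1) := by
    intro hd
    have e1 : b.1 - c.1 = (b.1 - a.1) - (c.1 - a.1) := by ring
    have e2 : b.2 - c.2 = (b.2 - a.2) - (c.2 - a.2) := by ring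
    have e3 : a.1 - b.1 = -(b.1 - a.1) := by ring
    have e4 : a.2 - b.2 = -(b.2 - a.2) := by ring
    have e5 : a.1 - c.1 = -(c.1 - a.1) := by ring
    have e6 : a.2 - c.2 = -(c.2 - a.2) := by ring
    simp only [SP, e1, e2, e3, e4, e5, e6] at pab pac pbc
    generalize b.1 - a.1 = p1 at *
    generalize b.2 - a.2 = p2 at *
    generalize c.1 - a.1 = q1 at *
    generalize c.2 - a.2 = q2 at *
    have hd' := Int.emod_eq_zero_of_dvd hd
    rw [Int.sub_emod, Int.mul_emod, Int.mul_emod p2] at hd'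
    rcases Int.emod_two_eq_zero_or_one p1 with h1 | h1 <;>
    rcases Int.emod_two_eq_zero_or_one p2 with h2 | h2 <;>
    rcases Int.emod_two_eq_zero_or_one q1 with h3 | h3 <;>
    rcases Int.emod_two_eq_zero_or_one q2 with h4 | h4 <;>
    simp only [h1, h2, h3, h4] at hd' <;> omega
  by_contra hcon
  push Not at hcon
  rcases lt_trichotomy ((b.1 - a.1) * (c.2 - a.2) - (b.2 - a.2) * (c.1 - a.1)) 0 with hl | hl | hl
  · obtain ⟨A, B, C, z, x1, x2, x3, x4, x5, x6, x7, x8, x9⟩ := tri_pt a c b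
      (-((b.1 - a.1) * (c.2 - a.2) - (b.2 - a.2) * (c.1 - a.1))) (by omega) (by ring)
    exact hinf ⟨z, fun i hi => tri_feas (u i) a c b z (h i) A B C _ (by omega) x1 x2 x3 x4 x5 x6 x7 x8 x9
      (ha i hi) (hc i hi) (hb i hi) (hac i hi) (hab i hi) (by linarith [hbc i hi])⟩
  · rw [hl] at hodd; simp at hodd
  · obtain ⟨A, B, C, z, x1, x2, x3, x4, x5, x6, x7, x8, x9⟩ := tri_pt a b c
      (((b.1 - a.1) * (c.2 - a.2) - (b.2 - a.2) * (c.1 - a.1))) (by omega) (by ring)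
    exact hinf ⟨z, fun i hi => tri_feas (u i) a b c z (h i) A B C _ (by omega) x1 x2 x3 x4 x5 x6 x7 x8 x9
      (ha i hi) (hb i hi) (hc i hi) (hab i hi) (hac i hi) (by linarith [hbc i hi])⟩

theorem coordz (o p q z : ℤ × ℤ) (hd : p.1 * q.2 - p.2 * q.1 = 1 ∨ p.1 * q.2 - p.2 * q.1 = -1) :
    ∃ x y : ℤ, z = (o.1 + x * p.1 + y * q.1, o.2 + x * p.2 + y * q.2) := by
  obtain ⟨ε, hε, hdet⟩ : ∃ ε : ℤ, ε * ε = 1 ∧ p.1 * q.2 - p.2 * q.1 = ε := by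
    rcases hd with h | h
    · exact ⟨1, by norm_num, h⟩
    · exact ⟨-1, by norm_num, h⟩
  refine ⟨ε * ((z.1 - o.1) * q.2 - (z.2 - o.2) * q.1), ε * (p.1 * (z.2 - o.2) - p.2 * (z.1 - o.1)), ?_⟩
  ext
  · simp only
    linear_combination (z.1 - o.1) * (-hε) - ε * (z.1 - o.1) * hdet
  · simp only
    linear_combination (z.2 - o.2) * (-hε) - ε * (z.2 - o.2) * hdet

theorem par4 (a b c d : ℤ × ℤ)
    (h1 : (b.1 - a.1) * (c.2 - a.2) - (b.2 - a.2) * (c.1 - a.1) = 1 ∨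
      (b.1 - a.1) * (c.2 - a.2) - (b.2 - a.2) * (c.1 - a.1) = -1)
    (h2 : (b.1 - a.1) * (d.2 - a.2) - (b.2 - a.2) * (d.1 - a.1) = 1 ∨
      (b.1 - a.1) * (d.2 - a.2) - (b.2 - a.2) * (d.1 - a.1) = -1)
    (h3 : (c.1 - a.1) * (d.2 - a.2) - (c.2 - a.2) * (d.1 - a.1) = 1 ∨
      (c.1 - a.1) * (d.2 - a.2) - (c.2 - a.2) * (d.1 - a.1) = -1)
    (h4 : (c.1 - b.1) * (d.2 - b.2) - (c.2 - b.2) * (d.1 - b.1) = 1 ∨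
      (c.1 - b.1) * (d.2 - b.2) - (c.2 - b.2) * (d.1 - b.1) = -1) :
    (a.1 + b.1 = c.1 + d.1 ∧ a.2 + b.2 = c.2 + d.2) ∨
    (a.1 + c.1 = b.1 + d.1 ∧ a.2 + c.2 = b.2 + d.2) ∨
    (a.1 + d.1 = b.1 + c.1 ∧ a.2 + d.2 = b.2 + c.2) := by
  obtain ⟨x, y, hxy⟩ := coordz a (b.1 - a.1, b.2 - a.2) (c.1 - a.1, c.2 - a.2) d h1
  have hd1 := congrArg Prod.fst hxy
  have hd2 := congrArg Prod.snd hxy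
  simp only at hd1 hd2
  obtain ⟨ε, hε, hdet⟩ : ∃ ε : ℤ, (ε = 1 ∨ ε = -1) ∧ (b.1 - a.1) * (c.2 - a.2) - (b.2 - a.2) * (c.1 - a.1) = ε := ⟨_, h1, rfl⟩
  have g2 : (b.1 - a.1) * (d.2 - a.2) - (b.2 - a.2) * (d.1 - a.1) = y * ε := by
    rw [hd1, hd2, ← hdet]; ring
  have g3 : (c.1 - a.1) * (d.2 - a.2) - (c.2 - a.2) * (d.1 - a.1) = -x * ε := by
    rw [hd1, hd2, ← hdet]; ring
  have g4 : (c.1 - b.1) * (d.2 - b.2) - (c.2 - b.2) * (d.1 - b.1) = (1 - x - y) * ε := by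
    rw [hd1, hd2, ← hdet]; ring
  rw [g2] at h2
  rw [g3] at h3
  rw [g4] at h4
  have key : (x = 1 ∧ y = 1) ∨ (x = 1 ∧ y = -1) ∨ (x = -1 ∧ y = 1) := by
    rcases hε with rfl | rfl <;> omega
  rcases key with ⟨rfl, rfl⟩ | ⟨rfl, rfl⟩ | ⟨rfl, rfl⟩
  · right; right; constructor <;> linarith
  · left; constructor <;> linarith
  · right; left; constructor <;> linarith

theorem scalA1 (A B C1 E1 C2 E2 x y x' y' : ℤ) (hA : 0 < A) (hB : B < 0)
    (hC1 : C1 < 0) (hC2 : 0 < C2) (hE2 : 0 < E2)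
    (hE1 : E1 < 0) (hne : (x, y) ≠ (x', y')) (heq : A * x + B * y = A * x' + B * y')
    (hlt : A * x + B * y < A) (g1 : C1 * x + E1 * y < 0) (g1' : C1 * x' + E1 * y' < 0)
    (g2 : C2 * x + E2 * y < C2 + E2) (g2' : C2 * x' + E2 * y' < C2 + E2) :
    ∃ x y : ℤ, x < 0 ∧ 0 < y ∧ C1 * x + E1 * y < 0 ∧ C2 * x + E2 * y < 0 := by
  wlog hxx : x ≤ x' generalizing x y x' y'
  · exact this x' y' x y hne.symm heq.symm (by omega) g1' g1 g2' g2 (by omega)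
  have hx1 : x < x' := by
    rcases hxx.lt_or_eq with h | h
    · exact h
    · exfalso; apply hne
      subst h
      have : B * y = B * y' := by linarith
      rw [mul_left_cancel₀ hB.ne this]
  have hy1 : y < y' := by
    by_contra hcon
    have := mul_pos hA (sub_pos.2 hx1)
    have := mul_nonneg (neg_nonneg.2 hB.le) (sub_nonneg.2 (not_lt.1 hcon))
    nlinarith
  have hyp : 0 < y := by
    by_contra hcon
    push Not at hcon
    have h1 : 0 ≤ E1 * y := mul_nonneg_of_nonpos_of_nonpos hE1.le hcon
    have h2 : 0 < x := by
      by_contra hc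
      push Not at hc
      have := mul_nonneg_of_nonpos_of_nonpos hC1.le hc
      omega
    have h3 : 0 ≤ B * y := mul_nonneg_of_nonpos_of_nonpos hB.le hcon
    nlinarith
  have h4 : 0 ≤ E2 * (y' - y - 1) := mul_nonneg hE2.le (by omega)
  have h5 : 0 ≤ C2 * (x' - x - 1) := mul_nonneg hC2.le (by omega)
  have h6 : C2 * x + E2 * y < 0 := by nlinarith
  have hxn : x < 0 := by
    by_contra hc
    push Not at hc
    have := mul_nonneg hC2.le hc
    have := mul_pos hE2 hyp
    omega
  exact ⟨x, y, hxn, hyp, g1, h6⟩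

theorem scalA2 (C1 E1 C2 E2 x y x' y' : ℤ) (hC1 : C1 < 0) (hC2 : 0 < C2)
    (hy : 0 < y) (hy' : y' < 0)
    (g1 : C1 * x + E1 * y < 0) (g1' : C1 * x' + E1 * y' < 0)
    (g2 : C2 * x + E2 * y < 0) (g2' : C2 * x' + E2 * y' < 0) : False := by
  have a1 : (C2 * E1 - C1 * E2) * y < 0 := by
    have := mul_pos_of_neg_of_neg hC1 g2
    have := mul_neg_of_pos_of_neg hC2 g1
    nlinarith
  have a2 : (C2 * E1 - C1 * E2) * y' < 0 := by
    have := mul_pos_of_neg_of_neg hC1 g2'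
    have := mul_neg_of_pos_of_neg hC2 g1'
    nlinarith
  have b1 := neg_of_mul_neg_left a1 hy.le
  have := mul_pos_of_neg_of_neg b1 hy'
  omega

theorem LL_coord (u o p q : ℤ × ℤ) (x y : ℤ) :
    LL u (o.1 + x * (p.1 - o.1) + y * (q.1 - o.1), o.2 + x * (p.2 - o.2) + y * (q.2 - o.2)) =
      LL u o + x * (LL u p - LL u o) + y * (LL u q - LL u o) := by
  simp only [LL]; ring

theorem caseA (u1 u2 w1 w2 a b c d : ℤ × ℤ) (h1 h2 k1 k2 : ℤ)
    (hdet : (c.1 - a.1) * (d.2 - a.2) - (c.2 - a.2) * (d.1 - a.1) = 1 ∨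
      (c.1 - a.1) * (d.2 - a.2) - (c.2 - a.2) * (d.1 - a.1) = -1)
    (hp1 : a.1 + b.1 = c.1 + d.1) (hp2 : a.2 + b.2 = c.2 + d.2)
    (u1a : LL u1 a < h1) (u1b : LL u1 b < h1) (u1c : LL u1 c = h1) (u1d : LL u1 d < h1)
    (u2a : LL u2 a < h2) (u2b : LL u2 b < h2) (u2c : LL u2 c < h2) (u2d : LL u2 d = h2)
    (w1a : LL w1 a = k1) (w1b : LL w1 b < k1) (w1c : LL w1 c < k1) (w1d : LL w1 d < k1)
    (w2a : LL w2 a < k2) (w2b : LL w2 b = k2) (w2c : LL w2 c < k2) (w2d : LL w2 d < k2)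
    (g g' e e' : ℤ × ℤ) (hg : g ≠ g') (he : e ≠ e')
    (ug : LL u1 g = LL u1 g') (ug' : LL u1 g < h1)
    (ue : LL u2 e = LL u2 e') (ue' : LL u2 e < h2)
    (w1g : LL w1 g < k1) (w1g' : LL w1 g' < k1) (w1e : LL w1 e < k1) (w1e' : LL w1 e' < k1)
    (w2g : LL w2 g < k2) (w2g' : LL w2 g' < k2) (w2e : LL w2 e < k2) (w2e' : LL w2 e' < k2) : False := by
  have hb : ∀ u, LL u b = LL u c + LL u d - LL u a := by
    intro u; simp only [LL]; linear_combination u.1 * hp1 + u.2 * hp2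
  obtain ⟨gx, gy, rfl⟩ := coordz a (c.1 - a.1, c.2 - a.2) (d.1 - a.1, d.2 - a.2) g hdet
  obtain ⟨gx', gy', rfl⟩ := coordz a (c.1 - a.1, c.2 - a.2) (d.1 - a.1, d.2 - a.2) g' hdet
  obtain ⟨ex, ey, rfl⟩ := coordz a (c.1 - a.1, c.2 - a.2) (d.1 - a.1, d.2 - a.2) e hdet
  obtain ⟨ex', ey', rfl⟩ := coordz a (c.1 - a.1, c.2 - a.2) (d.1 - a.1, d.2 - a.2) e' hdet
  simp only [LL_coord, hb] at *
  obtain ⟨x, y, hx, hy, r1, r2⟩ := scalA1 (LL u1 c - LL u1 a) (LL u1 d - LL u1 a)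
    (LL w1 c - LL w1 a) (LL w1 d - LL w1 a) (LL w2 c - LL w2 a) (LL w2 d - LL w2 a) gx gy gx' gy'
    (by omega) (by omega) (by omega) (by omega) (by omega) (by omega)
    (by intro h; apply hg; rw [Prod.mk.injEq] at h; rw [h.1, h.2])
    (by linarith) (by linarith) (by linarith) (by linarith) (by linarith) (by linarith)
  obtain ⟨y', x', hy', hx', r1', r2'⟩ := scalA1 (LL u2 d - LL u2 a) (LL u2 c - LL u2 a)
    (LL w1 d - LL w1 a) (LL w1 c - LL w1 a) (LL w2 d - LL w2 a) (LL w2 c - LL w2 a) ey ex ey' ex'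
    (by omega) (by omega) (by omega) (by omega) (by omega) (by omega)
    (by intro h; apply he; rw [Prod.mk.injEq] at h; rw [h.1, h.2])
    (by linarith) (by linarith) (by linarith) (by linarith) (by linarith) (by linarith)
  exact scalA2 (LL w1 c - LL w1 a) (LL w1 d - LL w1 a) (LL w2 c - LL w2 a) (LL w2 d - LL w2 a)
    x y x' y' (by omega) (by omega) hy hy' r1 (by linarith) r2 (by linarith)

theorem caseB (u1 u2 w1 w2 a b c d : ℤ × ℤ) (h1 h2 k1 k2 : ℤ)
    (hdet : (b.1 - a.1) * (c.2 - a.2) - (b.2 - a.2) * (c.1 - a.1) = 1 ∨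
      (b.1 - a.1) * (c.2 - a.2) - (b.2 - a.2) * (c.1 - a.1) = -1)
    (hp1 : a.1 + d.1 = b.1 + c.1) (hp2 : a.2 + d.2 = b.2 + c.2)
    (u1a : LL u1 a < h1) (u1c : LL u1 c = h1) (u1d : LL u1 d < h1)
    (u2b : LL u2 b < h2) (u2c : LL u2 c < h2) (u2d : LL u2 d = h2)
    (w1a : LL w1 a = k1) (w1b : LL w1 b < k1) (w1c : LL w1 c < k1)
    (w2a : LL w2 a < k2) (w2b : LL w2 b = k2) (w2d : LL w2 d < k2) :
    ∃ (φ : ℤ × ℤ) (s : ℤ), (∀ z, LL u1 z < h1 → LL u2 z < h2 → LL φ z ≤ s) ∧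
      (∀ z, LL w1 z < k1 → LL w2 z < k2 → s < LL φ z) := by
  have hd : ∀ u, LL u d = LL u b + LL u c - LL u a := by
    intro u; simp only [LL]; linear_combination u.1 * hp1 + u.2 * hp2
  obtain ⟨ε, hε, hdet'⟩ : ∃ ε : ℤ, ε * ε = 1 ∧
      (b.1 - a.1) * (c.2 - a.2) - (b.2 - a.2) * (c.1 - a.1) = ε := by
    rcases hdet with h | h
    · exact ⟨1, by norm_num, h⟩
    · exact ⟨-1, by norm_num, h⟩
  obtain ⟨φ, hφ⟩ : ∃ φ : ℤ × ℤ, φ = (-ε * (b.2 - a.2), ε * (b.1 - a.1)) := ⟨_, rfl⟩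
  have φb : LL φ b - LL φ a = 0 := by simp only [LL, hφ]; ring
  have φc : LL φ c - LL φ a = 1 := by
    simp only [LL, hφ]; linear_combination ε * hdet' + hε
  simp only [hd] at *
  refine ⟨φ, LL φ a, fun z z1 z2 => ?_, fun z z1 z2 => ?_⟩
  · obtain ⟨x, y, rfl⟩ := coordz a (b.1 - a.1, b.2 - a.2) (c.1 - a.1, c.2 - a.2) z hdet
    simp only [LL_coord] at *
    rw [φb, φc]
    by_contra hcon
    have hy : 1 ≤ y := by linarith
    have hx : 1 ≤ x := by
      by_contra hx
      have := mul_nonneg (show 0 ≤ y - 1 by omega) (show 0 ≤ LL u1 c - LL u1 a by omega)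
      have := mul_nonneg (show 0 ≤ -x by omega) (show 0 ≤ -(LL u1 b - LL u1 a) by omega)
      nlinarith
    have := mul_nonneg (show 0 ≤ y - 1 by omega) (show 0 ≤ LL u2 c - LL u2 a by omega)
    have := mul_nonneg (show 0 ≤ x - 1 by omega) (show 0 ≤ LL u2 b - LL u2 a by omega)
    nlinarith
  · obtain ⟨x, y, rfl⟩ := coordz a (b.1 - a.1, b.2 - a.2) (c.1 - a.1, c.2 - a.2) z hdet
    simp only [LL_coord] at *
    rw [φb, φc]
    by_contra hcon
    have hy : y ≤ 0 := by linarith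
    have hx : 1 ≤ x := by
      by_contra hx
      have := mul_nonneg (show 0 ≤ -y by omega) (show 0 ≤ -(LL w1 c - LL w1 a) by omega)
      have := mul_nonneg (show 0 ≤ -x by omega) (show 0 ≤ -(LL w1 b - LL w1 a) by omega)
      nlinarith
    have := mul_nonneg (show 0 ≤ -y by omega) (show 0 ≤ -(LL w2 c - LL w2 a) by omega)
    have := mul_nonneg (show 0 ≤ x - 1 by omega) (show 0 ≤ LL w2 b - LL w2 a by omega)
    nlinarith

theorem core_IDP {ι κ : Type*} [Fintype ι] [Fintype κ] (u : ι → ℤ × ℤ) (h : ι → ℤ)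
    (w : κ → ℤ × ℤ) (k : κ → ℤ)
    (hA : ∃ z, ∀ i, LL (u i) z ≤ h i) (hB : ∃ z, ∀ j, LL (w j) z ≤ k j)
    (sep : ∀ φ s, (∀ z, (∀ i, LL (u i) z ≤ h i) → LL φ z ≤ s) →
      (∀ z, (∀ j, LL (w j) z ≤ k j) → s < LL φ z) → False)
    (H : ∀ i, ∃ g g', g ≠ g' ∧ (∀ j, LL (w j) g ≤ k j) ∧ (∀ j, LL (w j) g' ≤ k j) ∧
      LL (u i) g = LL (u i) g' ∧ LL (u i) g ≤ h i) :
    ∃ z, (∀ i, LL (u i) z ≤ h i) ∧ (∀ j, LL (w j) z ≤ k j) := by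
  classical
  by_contra hcon
  obtain ⟨J, -, h', hh', hinf, hy⟩ := push_constraints (Finset.univ : Finset (ι ⊕ κ)) (Sum.elim u w)
    (Sum.elim (fun i => h i + 1) (fun j => k j + 1)) (by
      rintro ⟨z, hz⟩
      refine hcon ⟨z, fun i => ?_, fun j => ?_⟩
      · have := hz (Sum.inl i) (Finset.mem_univ _)
        simp only [Sum.elim_inl] at this
        omega
      · have := hz (Sum.inr j) (Finset.mem_univ _)
        simp only [Sum.elim_inr] at this
        omega)
  have hhl : ∀ i, h i + 1 ≤ h' (Sum.inl i) := fun i => hh' (Sum.inl i)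
  have hhr : ∀ j, k j + 1 ≤ h' (Sum.inr j) := fun j => hh' (Sum.inr j)
  have hP : ∃ i1 i2, i1 ≠ i2 ∧ Sum.inl i1 ∈ J ∧ Sum.inl i2 ∈ J := by
    by_contra hc
    push Not at hc
    by_cases hex : ∃ i0, Sum.inl i0 ∈ J
    · obtain ⟨i0, hi0⟩ := hex
      refine sep (u i0) (h i0) (fun z hz => hz i0) (fun z hz => ?_)
      by_contra hlt
      refine hinf ⟨z, ?_⟩
      rintro (i | j) hi
      · by_cases hii : i = i0
        · subst hii; have := hhl i; simp only [Sum.elim_inl]; omega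
        · exact absurd hi0 (hc i i0 hii hi)
      · have := hhr j; have := hz j; simp only [Sum.elim_inr]; omega
    · push Not at hex
      obtain ⟨z, hz⟩ := hB
      refine hinf ⟨z, ?_⟩
      rintro (i | j) hi
      · exact absurd hi (hex i)
      · have := hhr j; have := hz j; simp only [Sum.elim_inr]; omega
  have hR : ∃ i1 i2, i1 ≠ i2 ∧ Sum.inr i1 ∈ J ∧ Sum.inr i2 ∈ J := by
    by_contra hc
    push Not at hc
    by_cases hex : ∃ i0, Sum.inr i0 ∈ J
    · obtain ⟨i0, hi0⟩ := hex
      have hneg : ∀ z, LL (-w i0) z = - LL (w i0) z := by intro z; simp only [LL, Prod.fst_neg, Prod.snd_neg]; ring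
      refine sep (-w i0) (-k i0 - 1) (fun z hz => ?_) (fun z hz => by have := hz i0; rw [hneg]; omega)
      rw [hneg]
      by_contra hlt
      refine hinf ⟨z, ?_⟩
      rintro (i | j) hi
      · have := hhl i; have := hz i; simp only [Sum.elim_inl]; omega
      · by_cases hii : j = i0
        · subst hii; have := hhr j; simp only [Sum.elim_inr]; omega
        · exact absurd hi0 (hc j i0 hii hi)
    · push Not at hex
      obtain ⟨z, hz⟩ := hA
      refine hinf ⟨z, ?_⟩
      rintro (i | j) hi
      · have := hhl i; have := hz i; simp only [Sum.elim_inl]; omega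
      · exact absurd hi (hex j)
  choose y hy1 hy2 using hy
  have hle : ∀ i (hi : i ∈ J), ∀ j ∈ J, LL (Sum.elim u w j) (y i hi) ≤ h' j := by
    intro i hi j hj
    by_cases hji : j = i
    · subst hji; exact (hy1 j hi).le
    · exact (hy2 i hi j hj hji).le
  have hlt2 : ∀ i (hi : i ∈ J) i' (hi' : i' ∈ J), i ≠ i' → ∀ j ∈ J,
      LL (Sum.elim u w j) (y i hi) + LL (Sum.elim u w j) (y i' hi') < 2 * h' j := by
    intro i hi i' hi' hne j hj
    have a1 := hle i hi j hj
    have a2 := hle i' hi' j hj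
    by_cases hji : j = i
    · have := hy2 i' hi' j hj (by rw [hji]; exact hne)
      omega
    · have := hy2 i hi j hj hji
      omega
  have hpar : ∀ i (hi : i ∈ J) i' (hi' : i' ∈ J), i ≠ i' → ¬ SP (y i hi) (y i' hi') := by
    rintro i hi i' hi' hne ⟨⟨m, hm⟩, ⟨n, hn⟩⟩
    refine hinf ⟨((y i' hi').1 + m, (y i' hi').2 + n), fun j hj => ?_⟩
    have := hlt2 i hi i' hi' hne j hj
    simp only [LL] at this ⊢
    have e1 : (y i hi).1 = (y i' hi').1 + 2 * m := by omega
    have e2 : (y i hi).2 = (y i' hi').2 + 2 * n := by omega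
    rw [e1, e2] at this
    linarith
  have huni : ∀ i1 (m1 : i1 ∈ J) i2 (m2 : i2 ∈ J) i3 (m3 : i3 ∈ J), i1 ≠ i2 → i1 ≠ i3 → i2 ≠ i3 → _ :=
    fun i1 m1 i2 m2 i3 m3 n12 n13 n23 =>
      unimod J (Sum.elim u w) h' hinf (y i1 m1) (y i2 m2) (y i3 m3) (hle _ _) (hle _ _) (hle _ _)
      (hlt2 _ _ _ _ n12) (hlt2 _ _ _ _ n13) (hlt2 _ _ _ _ n23)
      (hpar _ _ _ _ n12) (hpar _ _ _ _ n13) (hpar _ _ _ _ n23)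
  obtain ⟨i1, i2, hi, mi1, mi2⟩ := hP
  obtain ⟨j1, j2, hj, mj1, mj2⟩ := hR
  have ni : (Sum.inl i1 : ι ⊕ κ) ≠ Sum.inl i2 := fun e => hi (Sum.inl_injective e)
  have nj : (Sum.inr j1 : ι ⊕ κ) ≠ Sum.inr j2 := fun e => hj (Sum.inr_injective e)
  have nij : ∀ (i : ι) (j : κ), (Sum.inl i : ι ⊕ κ) ≠ Sum.inr j := fun i j => Sum.inl_ne_inr
  have nji : ∀ (i : ι) (j : κ), (Sum.inr j : ι ⊕ κ) ≠ Sum.inl i := fun i j => Sum.inr_ne_inl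
  have sepB : (∃ (φ : ℤ × ℤ) (s : ℤ),
      (∀ z, LL (u i1) z < h' (Sum.inl i1) → LL (u i2) z < h' (Sum.inl i2) → LL φ z ≤ s) ∧
      (∀ z, LL (w j1) z < h' (Sum.inr j1) → LL (w j2) z < h' (Sum.inr j2) → s < LL φ z)) → False := by
    rintro ⟨φ, s, q1, q2⟩
    refine sep φ s (fun z hz => q1 z ?_ ?_) (fun z hz => q2 z ?_ ?_)
    · have := hhl i1; have := hz i1; omega
    · have := hhl i2; have := hz i2; omega
    · have := hhr j1; have := hz j1; omega
    · have := hhr j2; have := hz j2; omega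
  have T : ∀ i (mi : i ∈ J), LL (Sum.elim u w i) (y i mi) = h' i := hy1
  have Sx : ∀ i (mi : i ∈ J) j (mj : j ∈ J), j ≠ i → LL (Sum.elim u w j) (y i mi) < h' j := hy2
  rcases par4 (y _ mj1) (y _ mj2) (y _ mi1) (y _ mi2)
    (huni _ _ _ _ _ _ nj (nji _ _) (nji _ _)) (huni _ _ _ _ _ _ nj (nji _ _) (nji _ _))
    (huni _ _ _ _ _ _ (nji _ _) (nji _ _) ni) (huni _ _ _ _ _ _ (nji _ _) (nji _ _) ni) with
    ⟨e1, e2⟩ | ⟨e1, e2⟩ | ⟨e1, e2⟩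
  · obtain ⟨g, g', hg, gB, gB', gu, gh⟩ := H i1
    obtain ⟨f, f', hf, fB, fB', fu, fh⟩ := H i2
    have := hhl i1
    have := hhl i2
    have r1 := hhr j1
    have r2 := hhr j2
    exact caseA (u i1) (u i2) (w j1) (w j2) _ _ _ _ _ _ _ _
      (huni _ mj1 _ mi1 _ mi2 (nji _ _) (nji _ _) ni) e1 e2
      (Sx _ mj1 _ mi1 (nij _ _)) (Sx _ mj2 _ mi1 (nij _ _)) (T _ mi1) (Sx _ mi2 _ mi1 ni)
      (Sx _ mj1 _ mi2 (nij _ _)) (Sx _ mj2 _ mi2 (nij _ _)) (Sx _ mi1 _ mi2 ni.symm) (T _ mi2)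
      (T _ mj1) (Sx _ mj2 _ mj1 nj) (Sx _ mi1 _ mj1 (nji _ _)) (Sx _ mi2 _ mj1 (nji _ _))
      (Sx _ mj1 _ mj2 nj.symm) (T _ mj2) (Sx _ mi1 _ mj2 (nji _ _)) (Sx _ mi2 _ mj2 (nji _ _))
      g g' f f' hg hf gu (by omega) fu (by omega)
      ((Int.lt_add_one_of_le (gB _)).trans_le r1) ((Int.lt_add_one_of_le (gB' _)).trans_le r1)
      ((Int.lt_add_one_of_le (fB _)).trans_le r1) ((Int.lt_add_one_of_le (fB' _)).trans_le r1)
      ((Int.lt_add_one_of_le (gB _)).trans_le r2) ((Int.lt_add_one_of_le (gB' _)).trans_le r2)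
      ((Int.lt_add_one_of_le (fB _)).trans_le r2) ((Int.lt_add_one_of_le (fB' _)).trans_le r2)
  · apply sepB
    obtain ⟨φ, s, q1, q2⟩ := caseB (u i2) (u i1) (w j1) (w j2) _ _ _ _ _ _ _ _
      (huni _ mj1 _ mj2 _ mi2 nj (nji _ _) (nji _ _)) e1 e2
      (Sx _ mj1 _ mi2 (nij _ _)) (T _ mi2) (Sx _ mi1 _ mi2 ni.symm)
      (Sx _ mj2 _ mi1 (nij _ _)) (Sx _ mi2 _ mi1 ni) (T _ mi1)
      (T _ mj1) (Sx _ mj2 _ mj1 nj) (Sx _ mi2 _ mj1 (nji _ _))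
      (Sx _ mj1 _ mj2 nj.symm) (T _ mj2) (Sx _ mi1 _ mj2 (nji _ _))
    exact ⟨φ, s, fun z z1 z2 => q1 z z2 z1, q2⟩
  · apply sepB
    exact caseB (u i1) (u i2) (w j1) (w j2) _ _ _ _ _ _ _ _
      (huni _ mj1 _ mj2 _ mi1 nj (nji _ _) (nji _ _)) e1 e2
      (Sx _ mj1 _ mi1 (nij _ _)) (T _ mi1) (Sx _ mi2 _ mi1 ni)
      (Sx _ mj2 _ mi2 (nij _ _)) (Sx _ mi1 _ mi2 ni.symm) (T _ mi2)
      (T _ mj1) (Sx _ mj2 _ mj1 nj) (Sx _ mi1 _ mj1 (nji _ _))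
      (Sx _ mj1 _ mj2 nj.symm) (T _ mj2) (Sx _ mi2 _ mj2 (nji _ _))

/-- Real pairing. -/
def MM (p q : ℝ) (x : Fin 2 → ℝ) : ℝ := p * x 0 + q * x 1

theorem MM_add (p q : ℝ) (x y : Fin 2 → ℝ) : MM p q (x + y) = MM p q x + MM p q y := by
  simp only [MM, Pi.add_apply]; ring

theorem MM_smul (p q c : ℝ) (x : Fin 2 → ℝ) : MM p q (c • x) = c * MM p q x := by
  simp only [MM, Pi.smul_apply, smul_eq_mul]; ring

theorem MM_toR2 (u : ℤ × ℤ) (z : Fin 2 → ℤ) : MM u.1 u.2 (toR2 z) = (LL u (z 0, z 1) : ℤ) := by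
  simp only [MM, LL, toR2]; push_cast; ring

theorem hull_le (p q c : ℝ) (S : Set (Fin 2 → ℝ)) (h : ∀ v ∈ S, MM p q v ≤ c) :
    ∀ x ∈ convexHull ℝ S, MM p q x ≤ c := by
  have hc : Convex ℝ {x | MM p q x ≤ c} := by
    intro x hx y hy a b ha hb hab
    simp only [Set.mem_ofPred_eq] at *
    rw [MM_add, MM_smul, MM_smul]
    have : c = a * c + b * c := by rw [← add_mul, hab, one_mul]
    have := mul_le_mul_of_nonneg_left hx ha
    have := mul_le_mul_of_nonneg_left hy hb
    linarith
  exact fun x hx => convexHull_min (fun v hv => h v hv) hc hx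

theorem hull_sep (S : Set (Fin 2 → ℝ)) (hS : S.Finite) (x : Fin 2 → ℝ) (hx : x ∉ convexHull ℝ S) :
    ∃ p q c : ℝ, (∀ v ∈ convexHull ℝ S, MM p q v ≤ c) ∧ c < MM p q x := by
  obtain ⟨f, c, h1, h2⟩ := geometric_hahn_banach_closed_point (convex_convexHull ℝ S)
    (Set.Finite.isClosed_convexHull (𝕜 := ℝ) hS) hx
  have hf : ∀ y, f y = MM (f (Pi.single 0 1)) (f (Pi.single 1 1)) y := by
    intro y
    have : y = y 0 • (Pi.single 0 1 : Fin 2 → ℝ) + y 1 • (Pi.single 1 1 : Fin 2 → ℝ) := by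
      ext i; fin_cases i <;> simp
    conv_lhs => rw [this]
    rw [map_add, map_smul, map_smul]
    simp only [MM, smul_eq_mul]; ring
  refine ⟨f (Pi.single 0 1), f (Pi.single 1 1), c, fun v hv => ?_, ?_⟩
  · rw [← hf]; exact (h1 v hv).le
  · rw [← hf]; exact h2

/-- The normal of the segment from `v` to `w`. -/
def nrm (v w : Fin 2 → ℤ) : ℤ × ℤ := (-(w 1 - v 1), w 0 - v 0)

theorem facet (V : Finset (Fin 2 → ℤ)) (hV : V.Nonempty)
    (hdim : affineSpan ℝ (convexHull ℝ (toR2 '' (V : Set (Fin 2 → ℤ)))) = ⊤) (x : Fin 2 → ℝ)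
    (hx : x ∉ convexHull ℝ (toR2 '' (V : Set (Fin 2 → ℤ)))) :
    ∃ v ∈ V, ∃ w ∈ V, v ≠ w ∧ (∀ z ∈ V, LL (nrm v w) (z 0, z 1) ≤ LL (nrm v w) (v 0, v 1)) ∧
      (LL (nrm v w) (v 0, v 1) : ℝ) < MM (nrm v w).1 (nrm v w).2 x := by
  classical
  obtain ⟨p, q, c, hc1, hc2⟩ := hull_sep _ (V.finite_toSet.image _) x hx
  obtain ⟨v0, hv0, hmax⟩ := V.exists_max_image (fun v => MM p q (toR2 v)) hV
  have hv0x : MM p q (toR2 v0) < MM p q x :=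
    (hc1 _ (subset_convexHull ℝ _ ⟨v0, hv0, rfl⟩)).trans_lt hc2
  set d0 := x 0 - v0 0 with hd0
  set d1 := x 1 - v0 1 with hd1
  have hd : 0 < p * d0 + q * d1 := by
    simp only [MM, toR2] at hv0x; rw [hd0, hd1]; linarith
  -- a point off the line
  have hoff : ∃ w ∈ V, -d1 * (w 0 - v0 0) + d0 * (w 1 - v0 1) ≠ 0 := by
    by_contra hcon
    push Not at hcon
    set c0 := MM (-d1) d0 (toR2 v0) with hc0
    have hall : ∀ y ∈ convexHull ℝ (toR2 '' (V : Set (Fin 2 → ℤ))), MM (-d1) d0 y = c0 := by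
      intro y hy
      apply le_antisymm
      · refine hull_le (-d1) d0 c0 _ ?_ y hy
        rintro _ ⟨w, hw, rfl⟩
        have := hcon w hw
        simp only [MM, toR2, hc0]; linarith
      · have := hull_le (- -d1) (-d0) (-c0) _ ?_ y hy
        · simp only [MM] at this ⊢; linarith
        · rintro _ ⟨w, hw, rfl⟩
          have := hcon w hw
          simp only [MM, toR2, hc0]; linarith
    have hz : ∀ y : Fin 2 → ℝ, MM (-d1) d0 y = c0 := by
      intro y
      have hy : y ∈ affineSpan ℝ (convexHull ℝ (toR2 '' (V : Set (Fin 2 → ℤ)))) := by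
        rw [hdim]; trivial
      refine affineSpan_induction (p := fun y => MM (-d1) d0 y = c0) hy hall ?_
      intro c u v w hu hv hw
      simp only [MM, vsub_eq_sub, vadd_eq_add, Pi.add_apply, Pi.smul_apply, Pi.sub_apply, smul_eq_mul] at *
      linear_combination c * hu - c * hv + hw
    have z0 := hz 0
    have z1 := hz (fun i => if i = 0 then 1 else 0)
    have z2 := hz (fun i => if i = 0 then 0 else 1)
    simp [MM] at z0 z1 z2
    have e1 : d1 = 0 := by linarith
    have e2 : d0 = 0 := by linarith
    rw [e1, e2] at hd
    simp at hd
  obtain ⟨g0, g1, hgd, w0, hw0, hgw⟩ : ∃ g0 g1 : ℝ, g0 * d0 + g1 * d1 = 0 ∧ ∃ w ∈ V,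
      0 < g0 * (w 0 - v0 0) + g1 * (w 1 - v0 1) := by
    obtain ⟨w, hw, hne⟩ := hoff
    rcases lt_or_gt_of_ne hne with h | h
    · exact ⟨d1, -d0, by ring, w, hw, by linarith⟩
    · exact ⟨-d1, d0, by ring, w, hw, h⟩
  obtain ⟨w, hw, hmin⟩ := (V.filter (fun w => 0 < g0 * ((w 0 : ℝ) - v0 0) + g1 * (w 1 - v0 1))).exists_min_image
    (fun w => (MM p q (toR2 v0) - MM p q (toR2 w)) / (g0 * (w 0 - v0 0) + g1 * (w 1 - v0 1)))
    ⟨w0, by simp [hw0, hgw]⟩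
  simp only [Finset.mem_filter] at hw hmin
  obtain ⟨hwV, hwg⟩ := hw
  set s := (MM p q (toR2 v0) - MM p q (toR2 w)) / (g0 * ((w 0 : ℝ) - v0 0) + g1 * (w 1 - v0 1)) with hs
  have hs0 : 0 ≤ s := div_nonneg (sub_nonneg.2 (hmax w hwV)) hwg.le
  have hsw : s * (g0 * ((w 0 : ℝ) - v0 0) + g1 * (w 1 - v0 1)) = MM p q (toR2 v0) - MM p q (toR2 w) :=
    div_mul_cancel₀ _ hwg.ne'
  set F0 := p + s * g0 with hF0
  set F1 := q + s * g1 with hF1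
  have hFd : 0 < F0 * d0 + F1 * d1 := by
    have : F0 * d0 + F1 * d1 = p * d0 + q * d1 + s * (g0 * d0 + g1 * d1) := by rw [hF0, hF1]; ring
    rw [this, hgd]; linarith
  have hFw : F0 * ((w 0 : ℝ) - v0 0) + F1 * (w 1 - v0 1) = 0 := by
    simp only [MM, toR2] at hsw
    rw [hF0, hF1]; linear_combination hsw
  have hFz : ∀ z ∈ V, F0 * ((z 0 : ℝ) - v0 0) + F1 * (z 1 - v0 1) ≤ 0 := by
    intro z hz
    have e : F0 * ((z 0 : ℝ) - v0 0) + F1 * (z 1 - v0 1) =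
      (MM p q (toR2 z) - MM p q (toR2 v0)) + s * (g0 * ((z 0 : ℝ) - v0 0) + g1 * (z 1 - v0 1)) := by
      simp only [MM, toR2]; rw [hF0, hF1]; ring
    rw [e]
    have hm := hmax z hz
    by_cases hg : 0 < g0 * ((z 0 : ℝ) - v0 0) + g1 * (z 1 - v0 1)
    · have := hmin z ⟨hz, hg⟩
      rw [le_div_iff₀ hg] at this
      linarith
    · have := mul_nonneg hs0 (sub_nonneg.2 (not_lt.1 hg))
      linarith
  set e0 : ℝ := (w 0 : ℝ) - v0 0 with he0
  set e1 : ℝ := (w 1 : ℝ) - v0 1 with he1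
  have hN : 0 < e0 ^ 2 + e1 ^ 2 := by
    by_contra hcon
    have h0 : e0 = 0 := by nlinarith [sq_nonneg e0, sq_nonneg e1]
    have h1 : e1 = 0 := by nlinarith [sq_nonneg e0, sq_nonneg e1]
    rw [h0, h1] at hwg; simp at hwg
  have hvw : v0 ≠ w := by
    rintro rfl
    simp [he0, he1] at hN
  set κ := -F0 * e1 + F1 * e0 with hκ
  have hk : ∀ a b : ℝ, (e0 ^ 2 + e1 ^ 2) * (F0 * a + F1 * b) = κ * (-e1 * a + e0 * b) := by
    intro a b
    rw [hκ]
    linear_combination (a * e0 + b * e1) * hFw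
  have hx2 := hk d0 d1
  have hx3 := mul_pos hN hFd
  rw [hx2] at hx3
  rcases lt_trichotomy κ 0 with h | h | h
  · refine ⟨w, hwV, v0, hv0, hvw.symm, fun z hz => ?_, ?_⟩
    · have h1 := hk (z 0 - v0 0) (z 1 - v0 1)
      have h2 := mul_nonneg hN.le (neg_nonneg.2 (hFz z hz))
      have h3 : 0 ≤ -e1 * ((z 0 : ℝ) - v0 0) + e0 * (z 1 - v0 1) := by
        by_contra hc
        have := mul_pos_of_neg_of_neg h (not_le.1 hc)
        linarith
      have : (LL (nrm w v0) (z 0, z 1) : ℝ) ≤ (LL (nrm w v0) (w 0, w 1) : ℤ) := by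
        simp only [LL, nrm]; push_cast
        rw [he0, he1] at h3; linarith
      exact_mod_cast this
    · have h3 : -e1 * d0 + e0 * d1 < 0 := by
        by_contra hc
        have := mul_nonneg (neg_nonneg.2 h.le) (not_lt.1 hc)
        linarith
      simp only [LL, nrm, MM]; push_cast
      rw [he0, he1, hd0, hd1] at h3; linarith
  · rw [h] at hx3; simp at hx3
  · refine ⟨v0, hv0, w, hwV, hvw, fun z hz => ?_, ?_⟩
    · have h1 := hk (z 0 - v0 0) (z 1 - v0 1)
      have h2 := mul_nonneg hN.le (neg_nonneg.2 (hFz z hz))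
      have h3 : -e1 * ((z 0 : ℝ) - v0 0) + e0 * (z 1 - v0 1) ≤ 0 := by
        by_contra hc
        have := mul_pos h (not_le.1 hc)
        linarith
      have : (LL (nrm v0 w) (z 0, z 1) : ℝ) ≤ (LL (nrm v0 w) (v0 0, v0 1) : ℤ) := by
        simp only [LL, nrm]; push_cast
        rw [he0, he1] at h3; linarith
      exact_mod_cast this
    · have h3 : 0 < -e1 * d0 + e0 * d1 := by
        by_contra hc
        have := mul_nonneg h.le (neg_nonneg.2 (not_lt.1 hc))
        linarith
      simp only [LL, nrm, MM]; push_cast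
      rw [he0, he1, hd0, hd1] at h3; linarith

theorem toR2_add (a b : Fin 2 → ℤ) : toR2 (a + b) = toR2 a + toR2 b := by
  ext i; simp [toR2]

theorem LL_sub (u : ℤ × ℤ) (a b : Fin 2 → ℤ) :
    LL u (a 0 - b 0, a 1 - b 1) = LL u (a 0, a 1) - LL u (b 0, b 1) := by
  simp only [LL]; ring

theorem LL_neg (u : ℤ × ℤ) (z : ℤ × ℤ) : LL (-u) z = - LL u z := by
  simp only [LL, Prod.fst_neg, Prod.snd_neg]; ring

theorem weak_minkowski_summand_pair_IDP
    (P Q : Set (Fin 2 → ℝ))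
    (hQ : IsLatticePolytope2 Q) (hQdim : affineSpan ℝ Q = ⊤)
    (hP : IsLatticePolytope2 P)
    (hPQ : IsWeakMinkowskiSummand P Q) :
    (P + Q) ∩ Lat2 = (P ∩ Lat2) + (Q ∩ Lat2) := by
  classical
  obtain ⟨V, hV, rfl⟩ := hQ
  obtain ⟨W, hW, rfl⟩ := hP
  obtain ⟨_, ⟨V', hV', rfl⟩, k, hk, hsum⟩ := hPQ
  apply Set.Subset.antisymm
  swap
  · rintro _ ⟨p, ⟨hp, a, rfl⟩, q, ⟨hq, b, rfl⟩, rfl⟩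
    exact ⟨Set.add_mem_add hp hq, a + b, toR2_add a b⟩
  rintro _ ⟨⟨p, hp, q, hq, hpq⟩, X, rfl⟩
  simp only at hpq
  let F := (V ×ˢ V).filter (fun f => f.1 ≠ f.2 ∧
    ∀ z ∈ V, LL (nrm f.1 f.2) (z 0, z 1) ≤ LL (nrm f.1 f.2) (f.1 0, f.1 1))
  let u : F → ℤ × ℤ := fun f => nrm f.1.1 f.1.2
  let hq' : F → ℤ := fun f => LL (u f) (f.1.1 0, f.1.1 1)
  have hF : ∀ f : F, f.1.1 ∈ V ∧ f.1.2 ∈ V ∧ f.1.1 ≠ f.1.2 ∧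
      ∀ z ∈ V, LL (u f) (z 0, z 1) ≤ hq' f := by
    intro f
    have := f.2
    simp only [F, Finset.mem_filter, Finset.mem_product] at this
    exact ⟨this.1.1, this.1.2, this.2.1, this.2.2⟩
  have memQ : ∀ y : Fin 2 → ℝ, (∀ f : F, MM (u f).1 (u f).2 y ≤ hq' f) →
      y ∈ convexHull ℝ (toR2 '' (V : Set (Fin 2 → ℤ))) := by
    intro y hy
    by_contra hcon
    obtain ⟨v, hv, w, hw, hne, h1, h2⟩ := facet V hV hQdim y hcon
    have := hy ⟨(v, w), by simp only [F, Finset.mem_filter, Finset.mem_product]; exact ⟨⟨hv, hw⟩, hne, h1⟩⟩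
    exact absurd h2 (not_lt.2 this)
  have Qle : ∀ y ∈ convexHull ℝ (toR2 '' (V : Set (Fin 2 → ℤ))), ∀ f : F,
      MM (u f).1 (u f).2 y ≤ hq' f := by
    intro y hy f
    refine hull_le _ _ _ _ ?_ y hy
    rintro _ ⟨z, hz, rfl⟩
    rw [MM_toR2]; exact_mod_cast (hF f).2.2.2 z hz
  have hmaxP : ∀ f : F, ∃ v ∈ W, ∀ z ∈ W, LL (u f) (z 0, z 1) ≤ LL (u f) (v 0, v 1) :=
    fun f => W.exists_max_image (fun z => LL (u f) (z 0, z 1)) hW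
  choose m hmW hm using hmaxP
  let hp' : F → ℤ := fun f => LL (u f) (m f 0, m f 1)
  have Ple : ∀ y ∈ convexHull ℝ (toR2 '' (W : Set (Fin 2 → ℤ))), ∀ f : F,
      MM (u f).1 (u f).2 y ≤ hp' f := by
    intro y hy f
    refine hull_le _ _ _ _ ?_ y hy
    rintro _ ⟨z, hz, rfl⟩
    rw [MM_toR2]; exact_mod_cast hm f z hz
  have memP : ∀ y : Fin 2 → ℝ, (∀ f : F, MM (u f).1 (u f).2 y ≤ hp' f) →
      y ∈ convexHull ℝ (toR2 '' (W : Set (Fin 2 → ℤ))) := by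
    intro y hy
    by_contra hcon
    obtain ⟨a, b, c, hc1, hc2⟩ := hull_sep _ (W.finite_toSet.image _) y hcon
    obtain ⟨z, hz, hzmax⟩ := V'.exists_max_image (fun z => MM a b z) hV'
    have hzP' : z ∈ convexHull ℝ (V' : Set (Fin 2 → ℝ)) := subset_convexHull ℝ _ hz
    have hmem : k⁻¹ • (y + z) ∈ convexHull ℝ (toR2 '' (V : Set (Fin 2 → ℤ))) := by
      apply memQ
      intro f
      have h1 : toR2 (m f) + z ∈ k • convexHull ℝ (toR2 '' (V : Set (Fin 2 → ℤ))) := by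
        rw [← hsum]
        exact Set.add_mem_add (subset_convexHull ℝ _ ⟨m f, hmW f, rfl⟩) hzP'
      obtain ⟨r, hr, hr2⟩ := h1
      have h2 := Qle r hr f
      have h3 : MM (u f).1 (u f).2 (k • r) = MM (u f).1 (u f).2 (toR2 (m f) + z) := by
        simp only at hr2; rw [hr2]
      rw [MM_smul, MM_add, MM_toR2] at h3
      rw [MM_smul, MM_add, inv_mul_le_iff₀ hk]
      have h4 := hy f
      have h5 := mul_le_mul_of_nonneg_left h2 hk.le
      simp only [hp'] at h4
      linarith
    have h1 : y + z ∈ k • convexHull ℝ (toR2 '' (V : Set (Fin 2 → ℤ))) :=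
      ⟨_, hmem, by simp [smul_smul, hk.ne']⟩
    rw [← hsum] at h1
    obtain ⟨r, hr, t, ht, hrt⟩ := h1
    have h2 := hc1 r hr
    have h3 := hull_le a b _ _ (fun v hv => hzmax v hv) t ht
    have h4 : MM a b (r + t) = MM a b (y + z) := by simp only at hrt; rw [hrt]
    rw [MM_add, MM_add] at h4
    linarith
  have hXsum : ∀ a b, MM a b (toR2 X) = MM a b p + MM a b q := by
    intro a b; rw [← hpq, MM_add]
  have WA : ∀ z ∈ W, ∀ f, LL (u f) (z 0, z 1) ≤ hp' f := fun z hz f => hm f z hz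
  have VB : ∀ z ∈ V, ∀ f, LL (-u f) (X 0 - z 0, X 1 - z 1) ≤ hq' f - LL (u f) (X 0, X 1) := by
    intro z hz f
    have := (hF f).2.2.2 z hz
    rw [LL_neg, LL_sub]; omega
  obtain ⟨z, hz1, hz2⟩ := core_IDP u hp' (fun f => - u f) (fun f => hq' f - LL (u f) (X 0, X 1))
    (by obtain ⟨z, hz⟩ := hW; exact ⟨(z 0, z 1), WA z hz⟩)
    (by obtain ⟨z, hz⟩ := hV; exact ⟨_, VB z hz⟩)
    (by
      intro φ s h1 h2
      have a1 : MM φ.1 φ.2 p ≤ s := by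
        refine hull_le _ _ _ _ ?_ p hp
        rintro _ ⟨z, hz, rfl⟩
        rw [MM_toR2]; exact_mod_cast h1 _ (WA z hz)
      have a2 : MM φ.1 φ.2 q ≤ ((LL φ (X 0, X 1) - s - 1 : ℤ) : ℝ) := by
        refine hull_le _ _ _ _ ?_ q hq
        rintro _ ⟨z, hz, rfl⟩
        rw [MM_toR2]
        have := h2 _ (VB z hz)
        rw [LL_sub] at this
        have h3 : LL φ (z 0, z 1) ≤ LL φ (X 0, X 1) - s - 1 := by omega
        exact_mod_cast h3
      have a3 := hXsum φ.1 φ.2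
      rw [MM_toR2] at a3
      push_cast at a2
      linarith)
    (by
      intro f
      obtain ⟨f1, f2, f3, f4⟩ := hF f
      have huv : LL (u f) (f.1.2 0, f.1.2 1) = LL (u f) (f.1.1 0, f.1.1 1) := by
        simp only [u, LL, nrm]; ring
      refine ⟨_, _, ?_, VB _ f1, VB _ f2, ?_, ?_⟩
      · intro h
        rw [Prod.mk.injEq] at h
        apply f3
        ext i
        fin_cases i
        · simp only [Fin.zero_eta, Fin.mk_one]; omega
        · simp only [Fin.zero_eta, Fin.mk_one]; omega
      · rw [LL_sub, LL_sub, huv]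
      · rw [LL_sub]
        have b1 := Ple p hp f
        have b2 := Qle q hq f
        have b3 := hXsum (u f).1 (u f).2
        rw [MM_toR2] at b3
        have : ((LL (u f) (X 0, X 1) : ℤ) : ℝ) ≤ ((hp' f + hq' f : ℤ) : ℝ) := by push_cast; linarith
        have : LL (u f) (X 0, X 1) ≤ hp' f + hq' f := by exact_mod_cast this
        simp only [hq'] at this
        omega)
  let Z : Fin 2 → ℤ := ![z.1, z.2]
  have hZ : (Z 0, Z 1) = z := by simp [Z]
  refine ⟨toR2 Z, ⟨memP _ fun f => ?_, Z, rfl⟩, toR2 (X - Z), ⟨memQ _ fun f => ?_, X - Z, rfl⟩, ?_⟩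
  · rw [MM_toR2, hZ]; exact_mod_cast hz1 f
  · rw [MM_toR2]
    have := hz2 f
    rw [LL_neg, ← hZ] at this
    have h2 := LL_sub (u f) X Z
    have h3 : LL (u f) ((X - Z) 0, (X - Z) 1) ≤ hq' f := by
      simp only [Pi.sub_apply]; omega
    exact_mod_cast h3
  · simp only [← toR2_add]
    congr 1; abel
end
end
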